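/- arXiv:1510.00325 — 4 statements merged into one kernel-verified Lean document; each statement's English description precedes it below -/
import Mathlib

section
/- Let s > 1/2 and d ≥ 1. For every h > 0 there exist A > 0, B > 0 and C > 0 such that for every f ∈ Σ_s(ℝ^d) one has ‖f‖_{S_{s,h}} ≤ C ( sup_{x ∈ ℝ^d} e^{A|x|^{1/s}} |f(x)| + sup_{ξ ∈ ℝ^d} e^{B|ξ|^{1/s}} |f̂(ξ)| ), where f̂(ξ) = ∫_{ℝ^d} f(x) e^{−i⟨x,ξ⟩} dx. -/
open MeasureTheory Filter
open scoped BigOperators ENNReal RealInnerProductSpace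

noncomputable section

/-- `ℝ^d` with the Euclidean norm. -/
abbrev Ed (d : ℕ) : Type := EuclideanSpace ℝ (Fin d)

/-- Partial derivative along the `i`-th coordinate direction. -/
def pdGS {d : ℕ} (i : Fin d) (f : Ed d → ℂ) : Ed d → ℂ :=
  fun x => fderiv ℝ f x (EuclideanSpace.single i 1)

/-- Multi-index partial derivative `∂^β`. -/
def mderiv {d : ℕ} (β : Fin d → ℕ) (f : Ed d → ℂ) : Ed d → ℂ :=
  ((List.ofFn fun i : Fin d => (pdGS i)^[β i]).foldr (· ∘ ·) id) f

/-- Monomial `x^α`. -/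
def mpow {d : ℕ} (x : Ed d) (α : Fin d → ℕ) : ℝ := ∏ i, x i ^ α i

/-- Multi-index factorial `α!`. -/
def mfact {d : ℕ} (α : Fin d → ℕ) : ℕ := ∏ i, Nat.factorial (α i)

/-- Multi-index length `|α|`. -/
def mlen {d : ℕ} (α : Fin d → ℕ) : ℕ := ∑ i, α i

/-- The Gelfand–Shilov seminorm `‖f‖_{S_{s,h}}`, valued in `[0,∞]`. -/
def GSnorm {d : ℕ} (s h : ℝ) (f : Ed d → ℂ) : ℝ≥0∞ :=
  ⨆ (x : Ed d) (α : Fin d → ℕ) (β : Fin d → ℕ),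
    ENNReal.ofReal (|mpow x α| * ‖mderiv β f x‖ /
      (h ^ (mlen α + mlen β) * ((mfact α : ℝ) * (mfact β : ℝ)) ^ s))

/-- The Gelfand–Shilov space `Σ_s(ℝ^d)`: smooth functions all of whose
`S_{s,h}` seminorms are finite. -/
def SigmaGS (s : ℝ) (d : ℕ) : Set (Ed d → ℂ) :=
  {f | ContDiff ℝ ((⊤ : ℕ∞) : WithTop ℕ∞) f ∧ ∀ h : ℝ, 0 < h → GSnorm s h f < ⊤}

/-- The seminorm `|f|_A`, valued in `[0,∞]`. -/
def GSnormA {d : ℕ} (s A : ℝ) (f : Ed d → ℂ) : ℝ≥0∞ :=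
  ⨆ (x : Ed d) (β : Fin d → ℕ),
    ENNReal.ofReal (A ^ mlen β * Real.exp (A * ‖x‖ ^ (1/s)) * ‖mderiv β f x‖ /
      (mfact β : ℝ) ^ s)

/-- The Fourier transform `f̂(ξ) = ∫ f(x) e^{-i⟨x,ξ⟩} dx`. -/
def FTgs {d : ℕ} (f : Ed d → ℂ) (ξ : Ed d) : ℂ :=
  ∫ x : Ed d, f x * Complex.exp (-(Complex.I * (⟪x, ξ⟫ : ℝ)))

/-- The short-time Fourier transform of a function `f` with window `φ`. -/
def STFTgs {d : ℕ} (φ f : Ed d → ℂ) (z : Ed d × Ed d) : ℂ :=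
  ∫ y : Ed d, f y * (starRingEnd ℂ) (φ (y - z.1)) * Complex.exp (-(Complex.I * (⟪y, z.2⟫ : ℝ)))

/-- Euclidean norm of a phase-space point `(x,ξ) ∈ ℝ^{2d}`. -/
def pnorm {d : ℕ} (z : Ed d × Ed d) : ℝ := Real.sqrt (‖z.1‖ ^ 2 + ‖z.2‖ ^ 2)

/-- A conic subset: invariant under multiplication by positive reals. -/
def IsConic {V : Type*} [SMul ℝ V] (Γ : Set V) : Prop :=
  ∀ t : ℝ, 0 < t → ∀ z ∈ Γ, t • z ∈ Γ

/-- Tempered distributions on `ℝ^d`. -/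
abbrev TD (d : ℕ) : Type := SchwartzMap (Ed d) ℂ →L[ℂ] ℂ

/-- `W` is the short-time Fourier transform `V_φ u` of the tempered distribution `u`
with respect to the window `φ`. -/
def IsSTFT {d : ℕ} (u : TD d) (φ : Ed d → ℂ) (W : Ed d × Ed d → ℂ) : Prop :=
  ∀ (x ξ : Ed d) (g : SchwartzMap (Ed d) ℂ),
    (∀ y : Ed d, g y = (starRingEnd ℂ) (φ (y - x)) * Complex.exp (-(Complex.I * (⟪y, ξ⟫ : ℝ)))) →
    W (x, ξ) = u g

/-- The `s`-Gelfand–Shilov wave front set of a distribution whose short-time Fourier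
transform is `W`: the set of nonzero phase-space points having no open conic
neighbourhood on which `e^{A|z|^{1/s}} |W(z)|` is bounded for every `A > 0`. -/
def WFs {d : ℕ} (s : ℝ) (W : Ed d × Ed d → ℂ) : Set (Ed d × Ed d) :=
  {z₀ | z₀ ≠ 0 ∧ ¬ ∃ Γ : Set (Ed d × Ed d), IsOpen Γ ∧ IsConic Γ ∧
    (0 : Ed d × Ed d) ∉ Γ ∧ z₀ ∈ Γ ∧
    ∀ A : ℝ, 0 < A → ∃ C : ℝ, ∀ z ∈ Γ, Real.exp (A * pnorm z ^ (1/s)) * ‖W z‖ ≤ C}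

/-- The real quadratic form `⟨Bx, x⟩` of a matrix `B`. -/
def qf {d : ℕ} (B : Matrix (Fin d) (Fin d) ℝ) (x : Ed d) : ℝ :=
  ∑ i, (∑ j, B i j * x j) * x i

/-- Tempered distributions on `ℝ^m × ℝ^n`. -/
abbrev TD2 (m n : ℕ) : Type := SchwartzMap (Ed m × Ed n) ℂ →L[ℂ] ℂ

/-- Short-time Fourier transform of a tempered distribution on `ℝ^m × ℝ^n`. -/
def IsSTFT2 {m n : ℕ} (w : TD2 m n) (Φ : Ed m × Ed n → ℂ)
    (W : (Ed m × Ed n) × (Ed m × Ed n) → ℂ) : Prop :=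
  ∀ (x ξ : Ed m × Ed n) (g : SchwartzMap (Ed m × Ed n) ℂ),
    (∀ y : Ed m × Ed n, g y = (starRingEnd ℂ) (Φ (y - x)) *
      Complex.exp (-(Complex.I * ((⟪y.1, ξ.1⟫ + ⟪y.2, ξ.2⟫ : ℝ))))) →
    W (x, ξ) = w g

/-- Euclidean norm of a phase-space point of `T^*(ℝ^m × ℝ^n)`. -/
def pnorm2 {m n : ℕ} (z : (Ed m × Ed n) × (Ed m × Ed n)) : ℝ :=
  Real.sqrt (‖z.1.1‖ ^ 2 + ‖z.1.2‖ ^ 2 + ‖z.2.1‖ ^ 2 + ‖z.2.2‖ ^ 2)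

/-- The `s`-Gelfand–Shilov wave front set on `ℝ^m × ℝ^n`. -/
def WFs2 {m n : ℕ} (s : ℝ) (W : (Ed m × Ed n) × (Ed m × Ed n) → ℂ) :
    Set ((Ed m × Ed n) × (Ed m × Ed n)) :=
  {z₀ | z₀ ≠ 0 ∧ ¬ ∃ Γ : Set ((Ed m × Ed n) × (Ed m × Ed n)), IsOpen Γ ∧ IsConic Γ ∧
    (0 : (Ed m × Ed n) × (Ed m × Ed n)) ∉ Γ ∧ z₀ ∈ Γ ∧
    ∀ A : ℝ, 0 < A → ∃ C : ℝ, ∀ z ∈ Γ, Real.exp (A * pnorm2 z ^ (1/s)) * ‖W z‖ ≤ C}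

section LandauKolmogorov

open Polynomial in
lemma norm_coeff_prod_X_sub_C_le {ι : Type*} (S : Finset ι) (u : ι → ℂ)
    (hu : ∀ i ∈ S, ‖u i‖ ≤ 1) (k : ℕ) :
    ‖(∏ i ∈ S, (X - C (u i))).coeff k‖ ≤ 2 ^ S.card := by
  classical
  induction S using Finset.induction_on generalizing k with
  | empty =>
    simp only [Finset.prod_empty, Finset.card_empty, pow_zero, coeff_one]
    split_ifs <;> simp
  | insert a S ha ih =>
    have ih' := ih fun i hi => hu i (Finset.mem_insert_of_mem hi)
    have ha1 := hu a (Finset.mem_insert_self a S)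
    rw [Finset.prod_insert ha, Finset.card_insert_of_notMem ha, sub_mul, coeff_sub, coeff_C_mul,
      pow_succ, mul_two]
    refine (norm_sub_le _ _).trans (add_le_add ?_ ?_)
    · cases k with
      | zero => simp
      | succ k => rw [coeff_X_mul]; exact ih' k
    · rw [norm_mul]
      exact (mul_le_of_le_one_left (norm_nonneg _) ha1).trans (ih' k)

lemma prod_erase_abs_sub_eq (n i : ℕ) (hi : i < n) :
    ∏ j ∈ (Finset.range n).erase i, |(i : ℝ) - j| =
      (i.factorial : ℝ) * ((n - 1 - i).factorial : ℝ) := by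
  have hsplit : (Finset.range n).erase i = Finset.range i ∪ Finset.Ico (i + 1) n := by
    ext j
    simp only [Finset.mem_erase, Finset.mem_range, Finset.mem_union, Finset.mem_Ico]
    omega
  have hdisj : Disjoint (Finset.range i) (Finset.Ico (i + 1) n) := by
    rw [Finset.disjoint_left]
    intro j hj hj'
    simp only [Finset.mem_range, Finset.mem_Ico] at hj hj'
    omega
  rw [hsplit, Finset.prod_union hdisj]
  congr 1
  · rw [← Finset.prod_range_reflect, ← Finset.prod_range_add_one_eq_factorial]
    push_cast
    refine Finset.prod_congr rfl fun j hj => ?_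
    have hj := Finset.mem_range.1 hj
    rw [Nat.cast_sub (by omega), Nat.cast_sub (by omega)]
    push_cast
    rw [abs_of_nonneg] <;> [ring; skip]
    have : (0 : ℝ) ≤ j := j.cast_nonneg
    linarith
  · rw [Finset.prod_Ico_eq_prod_range, ← Finset.prod_range_add_one_eq_factorial]
    push_cast
    rw [show n - (i + 1) = n - 1 - i by omega]
    refine Finset.prod_congr rfl fun j _ => ?_
    rw [abs_sub_comm, abs_of_nonneg] <;> [ring; skip]
    have : (0 : ℝ) ≤ j := j.cast_nonneg
    linarith

lemma sum_pow_div_factorial_mul_factorial_le (m : ℕ) :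
    ∑ i ∈ Finset.range (m + 1), ((m + 1 : ℕ) : ℝ) ^ m / (i.factorial * (m - i).factorial : ℝ) ≤
      (2 * Real.exp 1) ^ (m + 1) := by
  have h1 : ∀ i ∈ Finset.range (m + 1),
      ((m + 1 : ℕ) : ℝ) ^ m / (i.factorial * (m - i).factorial : ℝ) =
        ((m + 1 : ℕ) : ℝ) ^ m / m.factorial * (m.choose i : ℝ) := by
    intro i hi
    rw [Nat.cast_choose ℝ (Nat.lt_succ_iff.1 (Finset.mem_range.1 hi))]
    field_simp
  rw [Finset.sum_congr rfl h1, ← Finset.mul_sum]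
  have h2 : ∑ i ∈ Finset.range (m + 1), (m.choose i : ℝ) = 2 ^ m := by
    exact_mod_cast Nat.sum_range_choose m
  rw [h2]
  have h3 := Real.pow_div_factorial_le_exp (x := ((m + 1 : ℕ) : ℝ)) (Nat.cast_nonneg _) m
  have h4 : Real.exp ((m + 1 : ℕ) : ℝ) = Real.exp 1 ^ (m + 1) := by
    rw [← Real.exp_nat_mul, mul_one]
  rw [h4] at h3
  calc _ ≤ Real.exp 1 ^ (m + 1) * 2 ^ (m + 1) := by
        gcongr
        · norm_num
        · omega
    _ = _ := by rw [mul_pow]; ring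

open Polynomial in
lemma norm_coeff_le_of_norm_eval_le {n : ℕ} (hn₀ : 0 < n) (p : ℂ[X]) (hp : p.degree < n) {M : ℝ}
    (hM : ∀ i < n, ‖p.eval ((i : ℂ) / n)‖ ≤ M) (k : ℕ) :
    ‖p.coeff k‖ ≤ (4 * Real.exp 1) ^ n * M := by
  obtain ⟨m, rfl⟩ : ∃ m, n = m + 1 := ⟨n - 1, by omega⟩
  set n := m + 1 with hn
  have hM0 : 0 ≤ M := (norm_nonneg _).trans (hM 0 (by omega))
  have hnC : (n : ℂ) ≠ 0 := by exact_mod_cast (by omega : n ≠ 0)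
  have hnR : (0 : ℝ) < n := by exact_mod_cast (by omega : 0 < n)
  let v : ℕ → ℂ := fun i => (i : ℂ) / n
  have hinj : Set.InjOn v (Finset.range n) := by
    intro i _ j _ hij
    have : (i : ℂ) = j := by simpa [v, hnC, div_left_inj'] using hij
    exact_mod_cast this
  have hinterp := Lagrange.eq_interpolate (s := Finset.range n) (v := v) hinj
    (f := p) (by simpa using hp)
  have hbasis : ∀ i ∈ Finset.range n, ‖(Lagrange.basis (Finset.range n) v i).coeff k‖ ≤
      2 ^ n * ((n : ℝ) ^ m / (i.factorial * (m - i).factorial : ℝ)) := by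
    intro i hi
    have hi' := Finset.mem_range.1 hi
    have hcard : ((Finset.range n).erase i).card = m := by
      rw [Finset.card_erase_of_mem hi, Finset.card_range]; omega
    have hprod : Lagrange.basis (Finset.range n) v i =
        C (∏ j ∈ (Finset.range n).erase i, (v i - v j)⁻¹) *
          ∏ j ∈ (Finset.range n).erase i, (X - C (v j)) := by
      rw [Lagrange.basis, map_prod, ← Finset.prod_mul_distrib]
      rfl
    rw [hprod, coeff_C_mul, norm_mul, norm_prod, mul_comm]
    refine mul_le_mul ?_ (le_of_eq ?_) (by positivity) (by positivity)
    · refine (norm_coeff_prod_X_sub_C_le _ _ (fun j hj => ?_) k).trans ?_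
      · have hj' := Finset.mem_range.1 (Finset.mem_of_mem_erase hj)
        simp only [v, norm_div, Complex.norm_natCast]
        rw [div_le_one hnR]
        exact_mod_cast hj'.le
      · rw [hcard]
        exact pow_le_pow_right₀ (by norm_num) (by omega)
    · have h1 : ∀ j ∈ (Finset.range n).erase i, ‖(v i - v j)⁻¹‖ =
          n * |(i : ℝ) - j|⁻¹ := by
        intro j _
        have : v i - v j = (((i : ℝ) - j : ℝ) : ℂ) / n := by
          simp only [v]; push_cast; ring
        rw [this, norm_inv, norm_div, Complex.norm_real, Complex.norm_natCast, inv_div,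
          div_eq_mul_inv, Real.norm_eq_abs]
      rw [Finset.prod_congr rfl h1, Finset.prod_mul_distrib, Finset.prod_const, hcard,
        Finset.prod_inv_distrib, prod_erase_abs_sub_eq n i hi', div_eq_mul_inv]
      rfl
  rw [hinterp, Lagrange.interpolate_apply, finsetSum_coeff]
  calc _ ≤ ∑ i ∈ Finset.range n,
        M * (2 ^ n * ((n : ℝ) ^ m / (i.factorial * (m - i).factorial : ℝ))) := by
        refine norm_sum_le_of_le _ fun i hi => ?_
        rw [coeff_C_mul, norm_mul]
        exact mul_le_mul (hM i (Finset.mem_range.1 hi)) (hbasis i hi) (norm_nonneg _) hM0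
    _ = M * 2 ^ n *
        ∑ i ∈ Finset.range n, ((n : ℝ) ^ m / (i.factorial * (m - i).factorial : ℝ)) := by
        rw [Finset.mul_sum]
        exact Finset.sum_congr rfl fun i _ => by ring
    _ ≤ M * 2 ^ n * (2 * Real.exp 1) ^ n := by
        gcongr
        exact sum_pow_div_factorial_mul_factorial_le m
    _ = _ := by
        rw [mul_assoc, ← mul_pow, mul_comm]; ring_nf

lemma norm_sub_taylor_sum_le (n : ℕ) (g : ℕ → ℝ → ℂ)
    (hg : ∀ j t, HasDerivAt (g j) (g (j + 1) t) t) {M : ℝ}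
    (hM : ∀ t, 0 ≤ t → ‖g n t‖ ≤ M) (t : ℝ) (ht : 0 ≤ t) :
    ‖g 0 t - ∑ j ∈ Finset.range n, g j 0 * (t : ℂ) ^ j / (j.factorial : ℂ)‖ ≤
      M * t ^ n / n.factorial := by
  induction n generalizing g t with
  | zero => simpa using hM t ht
  | succ n ih =>
    have ih' := ih (fun j => g (j + 1)) (fun j t => hg (j + 1) t) hM
    let F : ℝ → ℂ := fun t =>
      g 0 t - ∑ j ∈ Finset.range (n + 1), g j 0 * (t : ℂ) ^ j / (j.factorial : ℂ)
    let F' : ℝ → ℂ := fun t =>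
      g 1 t - ∑ j ∈ Finset.range n, g (j + 1) 0 * (t : ℂ) ^ j / (j.factorial : ℂ)
    have hF : ∀ x, HasDerivAt F (F' x) x := by
      intro x
      refine (hg 0 x).sub ?_
      have hterm : ∀ j : ℕ, HasDerivAt (fun t : ℝ => g j 0 * (t : ℂ) ^ j / (j.factorial : ℂ))
          (g j 0 * ((j : ℂ) * (x : ℂ) ^ (j - 1)) / (j.factorial : ℂ)) x := by
        intro j
        have := (Complex.ofRealCLM.hasDerivAt (x := x)).pow j
        simp only [Complex.ofRealCLM_apply, Complex.ofReal_one, mul_one] at this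
        exact (this.const_mul (g j 0)).div_const _
      have hsum := HasDerivAt.fun_sum (u := Finset.range (n + 1)) fun j _ => hterm j
      convert! hsum using 1
      rw [Finset.sum_range_succ']
      simp only [Nat.cast_zero, zero_mul, mul_zero, zero_div, add_zero, Nat.add_sub_cancel]
      refine Finset.sum_congr rfl fun j _ => ?_
      rw [Nat.factorial_succ]
      have h1 : ((j : ℂ) + 1) ≠ 0 := by exact_mod_cast Nat.succ_ne_zero j
      have h2 : (j.factorial : ℂ) ≠ 0 := by exact_mod_cast j.factorial_ne_zero
      push_cast
      field_simp
    have hB : ∀ x : ℝ, HasDerivAt (fun x : ℝ => M * x ^ (n + 1) / (n + 1).factorial)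
        (M * x ^ n / n.factorial) x := by
      intro x
      convert! (((hasDerivAt_id x).pow (n + 1)).const_mul M).div_const
        ((n + 1).factorial : ℝ) using 1
      rw [Nat.factorial_succ]
      have h2 : (n.factorial : ℝ) ≠ 0 := by exact_mod_cast n.factorial_ne_zero
      push_cast
      simp only [id, mul_one]
      field_simp
    have := image_norm_le_of_norm_deriv_right_le_deriv_boundary (f := F) (f' := F') (a := 0) (b := t)
      (fun x _ => (hF x).continuousAt.continuousWithinAt)
      (fun x _ => (hF x).hasDerivWithinAt)
      (B := fun x : ℝ => M * x ^ (n + 1) / (n + 1).factorial)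
      (by simp [F, Finset.sum_range_succ']) hB (fun x hx => ih' x hx.1)
    exact this ⟨ht, le_rfl⟩

open Polynomial in
lemma norm_deriv_le_of_norm_le {n : ℕ} (g : ℕ → ℝ → ℂ)
    (hg : ∀ j t, HasDerivAt (g j) (g (j + 1) t) t) {M₀ M : ℝ}
    (hM₀ : ∀ t, 0 ≤ t → ‖g 0 t‖ ≤ M₀) (hM : ∀ t, 0 ≤ t → ‖g n t‖ ≤ M)
    {r : ℝ} (hr : 0 < r) {k : ℕ} (hk : k < n) :
    ‖g k 0‖ ≤ k.factorial * (4 * Real.exp 1) ^ n * (M₀ + M * r ^ n / n.factorial) / r ^ k := by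
  have hn : 0 < n := by omega
  let p : ℂ[X] := ∑ j ∈ Finset.range n, monomial j (g j 0 * (r : ℂ) ^ j / (j.factorial : ℂ))
  have hdeg : p.degree < n := by
    refine mem_degreeLT.1 (Submodule.sum_mem _ fun j hj => mem_degreeLT.2 ?_)
    exact (degree_monomial_le _ _).trans_lt (by exact_mod_cast Finset.mem_range.1 hj)
  have hMn : 0 ≤ M := (norm_nonneg _).trans (hM 0 le_rfl)
  have heval : ∀ i < n, ‖p.eval ((i : ℂ) / n)‖ ≤ M₀ + M * r ^ n / n.factorial := by
    intro i hi
    have hnR : (0 : ℝ) < n := by exact_mod_cast hn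
    have hin : (i : ℝ) / n ≤ 1 := by
      rw [div_le_one hnR]; exact_mod_cast hi.le
    have ht0 : 0 ≤ r * ((i : ℝ) / n) := by positivity
    have htr : r * ((i : ℝ) / n) ≤ r := mul_le_of_le_one_right hr.le hin
    have hT := norm_sub_taylor_sum_le n g hg hM _ ht0
    have hpe : p.eval ((i : ℂ) / n) = ∑ j ∈ Finset.range n,
        g j 0 * ((r * ((i : ℝ) / n) : ℝ) : ℂ) ^ j / (j.factorial : ℂ) := by
      simp only [p, eval_finsetSum, eval_monomial]
      refine Finset.sum_congr rfl fun j _ => ?_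
      push_cast
      rw [mul_pow]
      ring
    rw [hpe]
    rw [norm_sub_rev] at hT
    have h2 : M * (r * ((i : ℝ) / n)) ^ n / n.factorial ≤ M * r ^ n / n.factorial := by gcongr
    have := norm_le_norm_add_norm_sub' (∑ j ∈ Finset.range n,
        g j 0 * ((r * ((i : ℝ) / n) : ℝ) : ℂ) ^ j / (j.factorial : ℂ)) (g 0 (r * ((i : ℝ) / n)))
    linarith [hM₀ _ ht0]
  have hc := norm_coeff_le_of_norm_eval_le hn p hdeg heval k
  have hcoef : p.coeff k = g k 0 * (r : ℂ) ^ k / (k.factorial : ℂ) := by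
    simp only [p, finsetSum_coeff, coeff_monomial]
    rw [Finset.sum_ite_eq' (Finset.range n) k, if_pos (Finset.mem_range.2 hk)]
  rw [hcoef, norm_div, norm_mul, norm_pow, Complex.norm_real, Complex.norm_natCast,
    Real.norm_of_nonneg hr.le, div_le_iff₀ (by positivity)] at hc
  rw [le_div_iff₀ (by positivity)]
  linarith

end LandauKolmogorov

section CoordinatewiseDecay

/-- The constant by which interpolation between a decaying function and its Gevrey-type
derivative bounds enlarges the Gevrey radius. -/
def gevreyLoss (s : ℝ) : ℝ := (4 * Real.exp 1) ^ 2 * 2 ^ s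

lemma one_le_gevreyLoss {s : ℝ} (hs : 0 < s) : 1 ≤ gevreyLoss s := by
  have h1 : (1 : ℝ) ≤ Real.exp 1 := Real.one_le_exp zero_le_one
  have h2 : (1 : ℝ) ≤ 2 ^ s := Real.one_le_rpow (by norm_num) hs.le
  have h3 : (1 : ℝ) ≤ (4 * Real.exp 1) ^ 2 := one_le_pow₀ (by linarith)
  exact one_le_mul_of_one_le_of_one_le h3 h2

lemma factorial_two_mul_le_sq (k : ℕ) :
    ((2 * k).factorial : ℝ) ≤ (2 ^ k * k.factorial) ^ 2 := by
  have h1 := Nat.choose_mul_factorial_mul_factorial (n := 2 * k) (k := k) (by omega)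
  have h2 : (2 * k).choose k ≤ 2 ^ (2 * k) := Nat.choose_le_two_pow _ _
  rw [show 2 * k - k = k by omega] at h1
  have h3 : (2 * k).factorial ≤ 2 ^ (2 * k) * (k.factorial * k.factorial) := by
    rw [← h1, mul_assoc]
    exact Nat.mul_le_mul_right _ h2
  calc ((2 * k).factorial : ℝ) ≤ 2 ^ (2 * k) * (k.factorial * k.factorial) := by exact_mod_cast h3
    _ = _ := by ring

lemma factorial_sq_le_factorial_two_mul (k : ℕ) :
    (k.factorial : ℝ) ^ 2 ≤ ((2 * k).factorial : ℝ) := by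
  have := Nat.factorial_mul_factorial_dvd_factorial_add k k
  have := Nat.le_of_dvd (Nat.factorial_pos _) this
  rw [sq, two_mul]
  exact_mod_cast this

lemma norm_deriv_le_of_decay_of_gevrey {s H Q ε : ℝ} (hs : 0 < s) (hH : 0 < H) (hQ : 0 ≤ Q)
    (hε : 0 < ε) (hε1 : ε ≤ 1) (k : ℕ) (g : ℕ → ℝ → ℂ)
    (hg : ∀ j t, HasDerivAt (g j) (g (j + 1) t) t)
    (h0 : ∀ t, 0 ≤ t → ‖g 0 t‖ ≤ Q * ε ^ 2)
    (h2 : ∀ t, 0 ≤ t → ‖g (2 * k) t‖ ≤ Q * H ^ (2 * k) * ((2 * k).factorial : ℝ) ^ s) :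
    ‖g k 0‖ ≤ 2 * Q * ε * (gevreyLoss s * H) ^ k * (k.factorial : ℝ) ^ s := by
  rcases Nat.eq_zero_or_pos k with rfl | hk
  · have := h0 0 le_rfl
    have h4 : ε ^ 2 ≤ ε := by nlinarith
    have h5 := mul_le_mul_of_nonneg_left h4 hQ
    have h6 : 0 ≤ Q * ε := by positivity
    simp only [pow_zero, mul_one, Nat.factorial_zero, Nat.cast_one, Real.one_rpow]
    linarith
  set Φ : ℝ := √((2 * k).factorial : ℝ) with hΦ
  have hΦsq : Φ ^ 2 = ((2 * k).factorial : ℝ) := Real.sq_sqrt (by positivity)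
  have hΦpos : 0 < Φ := Real.sqrt_pos.2 (by positivity)
  have hΦ1 : (k.factorial : ℝ) ≤ Φ :=
    Real.le_sqrt_of_sq_le (factorial_sq_le_factorial_two_mul k)
  have hΦ2 : Φ ≤ 2 ^ k * k.factorial :=
    Real.sqrt_le_left (by positivity) |>.2 (factorial_two_mul_le_sq k)
  set R : ℝ := ε * Φ ^ (1 - s) / H ^ k with hR
  have hRpos : 0 < R := by positivity
  set r : ℝ := R ^ ((k : ℝ)⁻¹) with hr
  have hrpos : 0 < r := by positivity
  have hrk : r ^ k = R := Real.rpow_inv_natCast_pow hRpos.le hk.ne'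
  have key := norm_deriv_le_of_norm_le g hg h0 h2 hrpos (show k < 2 * k by omega)
  have hΦs : ((2 * k).factorial : ℝ) ^ s = (Φ ^ s) ^ 2 := by
    rw [← hΦsq, ← Real.rpow_natCast, ← Real.rpow_natCast, ← Real.rpow_mul hΦpos.le,
      ← Real.rpow_mul hΦpos.le, mul_comm]
  have hΦm : Φ ^ (1 - s) * Φ ^ s = Φ := by
    rw [← Real.rpow_add hΦpos]; simp
  have hsecond : Q * H ^ (2 * k) * ((2 * k).factorial : ℝ) ^ s * r ^ (2 * k) /
      (2 * k).factorial = Q * ε ^ 2 := by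
    rw [mul_comm 2 k, pow_mul, pow_mul, hrk, mul_comm k 2, hΦs, ← hΦsq, hR]
    have : (H ^ k) ^ 2 * (Φ ^ s) ^ 2 * (ε * Φ ^ (1 - s) / H ^ k) ^ 2 = ε ^ 2 * Φ ^ 2 := by
      rw [div_pow, mul_pow ε, ← hΦm]
      simp only [hΦm]
      field_simp
      rw [← mul_pow, mul_comm (Φ ^ s), hΦm]
    rw [div_eq_iff (by positivity)]
    linear_combination Q * this
  rw [hsecond, hrk] at key
  refine key.trans ?_
  have hfinal : (k.factorial : ℝ) / Φ ^ (1 - s) ≤ (2 ^ s) ^ k * (k.factorial : ℝ) ^ s := by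
    have e1 : Φ ^ s ≤ (2 ^ k * k.factorial : ℝ) ^ s :=
      Real.rpow_le_rpow hΦpos.le hΦ2 hs.le
    have e2 : (2 ^ k * k.factorial : ℝ) ^ s = (2 ^ s) ^ k * (k.factorial : ℝ) ^ s := by
      rw [Real.mul_rpow (by positivity) (by positivity), ← Real.rpow_natCast 2,
        ← Real.rpow_natCast (2 ^ s), ← Real.rpow_mul (by norm_num),
        ← Real.rpow_mul (by norm_num), mul_comm s]
    rw [← e2]
    refine le_trans ?_ e1
    rw [div_le_iff₀ (by positivity), mul_comm, hΦm]
    exact hΦ1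
  calc _ = 2 * Q * ε * ((4 * Real.exp 1) ^ 2 * H) ^ k * (k.factorial / Φ ^ (1 - s)) := by
        rw [hR, pow_mul, mul_pow _ H]
        field_simp
        ring
    _ ≤ 2 * Q * ε * ((4 * Real.exp 1) ^ 2 * H) ^ k *
        ((2 ^ s) ^ k * (k.factorial : ℝ) ^ s) := by gcongr
    _ = _ := by
        simp only [gevreyLoss, mul_pow]
        ring

variable {d : ℕ}

lemma mlen_add_single (β : Fin d → ℕ) (i : Fin d) (k : ℕ) :
    mlen (β + Pi.single i k) = mlen β + k := by
  simp [mlen, Finset.sum_add_distrib]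

lemma mfact_add_single (β : Fin d → ℕ) (i : Fin d) (hi : β i = 0) (k : ℕ) :
    mfact (β + Pi.single i k) = mfact β * k.factorial := by
  have hne : ∀ j ∈ (Finset.univ : Finset (Fin d)).erase i,
      ((β + Pi.single i k : Fin d → ℕ) j).factorial = (β j).factorial := by
    intro j hj
    simp [Pi.single_eq_of_ne (Finset.ne_of_mem_erase hj)]
  rw [mfact, mfact, ← Finset.mul_prod_erase _ _ (Finset.mem_univ i),
    ← Finset.mul_prod_erase _ _ (Finset.mem_univ i), Finset.prod_congr rfl hne]
  simp [hi, mul_comm]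

lemma norm_le_norm_add_smul_single (x : Ed d) (i : Fin d) {a : ℝ} (ha : 0 ≤ a * x i) :
    ‖x‖ ≤ ‖x + a • (EuclideanSpace.single i (1 : ℝ) : Ed d)‖ := by
  have h1 := norm_add_sq_real x (a • (EuclideanSpace.single i (1 : ℝ) : Ed d))
  rw [inner_smul_right, EuclideanSpace.inner_single_right] at h1
  simp only [one_mul, conj_trivial] at h1
  refine le_of_sq_le_sq ?_ (norm_nonneg _)
  nlinarith [sq_nonneg ‖a • (EuclideanSpace.single i (1 : ℝ) : Ed d)‖]

lemma norm_le_of_decay_of_gevrey {s H Q A : ℝ} (hs : 0 < s) (hH : 0 < H) (hQ : 0 ≤ Q)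
    (hA : 0 ≤ A) (u : (Fin d → ℕ) → Ed d → ℂ)
    (hu : ∀ β i x (t : ℝ), HasDerivAt
      (fun t : ℝ => u β (x + t • (EuclideanSpace.single i (1 : ℝ) : Ed d)))
      (u (β + Pi.single i 1) (x + t • (EuclideanSpace.single i (1 : ℝ) : Ed d))) t)
    (h0 : ∀ x, ‖u 0 x‖ ≤ Q * Real.exp (-A * ‖x‖ ^ (1 / s)))
    (hβ : ∀ β x, ‖u β x‖ ≤ Q * H ^ mlen β * (mfact β : ℝ) ^ s)
    (S : Finset (Fin d)) (β : Fin d → ℕ) (hS : ∀ i ∉ S, β i = 0) (x : Ed d) :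
    ‖u β x‖ ≤ 2 ^ S.card * Q * (gevreyLoss s * H) ^ mlen β * (mfact β : ℝ) ^ s *
      Real.exp (-(A / 2 ^ S.card) * ‖x‖ ^ (1 / s)) := by
  induction S using Finset.induction_on generalizing β x with
  | empty =>
    have : β = 0 := funext fun i => hS i (Finset.notMem_empty i)
    subst this
    simpa [mlen, mfact] using h0 x
  | insert i S hi ih =>
    have hL := one_le_gevreyLoss hs
    set e : Ed d := EuclideanSpace.single i (1 : ℝ) with he
    set c := S.card with hc
    set β' : Fin d → ℕ := Function.update β i 0 with hβ'
    have hβ'i : β' i = 0 := by simp [hβ']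
    have hβ'S : ∀ j ∉ S, β' j = 0 := by
      intro j hj
      by_cases hji : j = i
      · rw [hji, hβ'i]
      · rw [hβ', Function.update_of_ne hji]
        exact hS j (by simp [hji, hj])
    have hdecomp : β = β' + Pi.single i (β i) := by
      funext j
      by_cases hji : j = i
      · subst hji; simp [hβ']
      · simp [hβ', Function.update_of_ne hji, Pi.single_eq_of_ne hji]
    obtain ⟨σ, hσ, hσx⟩ : ∃ σ : ℝ, |σ| = 1 ∧ 0 ≤ σ * x i := by
      rcases le_total 0 (x i) with h | h
      · exact ⟨1, by simp, by simpa using h⟩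
      · exact ⟨-1, by simp, by simpa using h⟩
    set k := β i with hk
    let g : ℕ → ℝ → ℂ := fun j t => (σ : ℂ) ^ j * u (β' + Pi.single i j) (x + (σ * t) • e)
    have hσn : ‖(σ : ℂ)‖ = 1 := by rw [Complex.norm_real, Real.norm_eq_abs, hσ]
    have hgn : ∀ j t, ‖g j t‖ = ‖u (β' + Pi.single i j) (x + (σ * t) • e)‖ := by
      intro j t
      simp [g, hσ]
    have hg : ∀ j t, HasDerivAt (g j) (g (j + 1) t) t := by
      intro j t
      have h1 := hu (β' + Pi.single i j) i x (σ * t)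
      have h2 : HasDerivAt (fun t : ℝ => σ * t) σ t := by
        simpa using (hasDerivAt_id t).const_mul σ
      have h3 := (h1.scomp t h2).const_mul ((σ : ℂ) ^ j)
      convert! h3 using 1
      simp only [g]
      rw [add_assoc, ← Pi.single_add, Complex.real_smul, pow_succ, mul_assoc]
    set ε : ℝ := Real.exp (-(A / 2 ^ (c + 1)) * ‖x‖ ^ (1 / s)) with hε
    have hε1 : ε ≤ 1 := by
      rw [hε, Real.exp_le_one_iff, neg_mul, neg_nonpos]
      positivity
    have hεsq : ε ^ 2 = Real.exp (-(A / 2 ^ c) * ‖x‖ ^ (1 / s)) := by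
      rw [hε, ← Real.exp_nat_mul]
      congr 1
      push_cast
      field_simp
      ring
    set Q' : ℝ := 2 ^ c * Q * (gevreyLoss s * H) ^ mlen β' * (mfact β' : ℝ) ^ s with hQ'
    have hLpos : 0 < gevreyLoss s := by linarith
    have hQ'0 : 0 ≤ Q' := by positivity
    have hg0 : ∀ t, 0 ≤ t → ‖g 0 t‖ ≤ Q' * ε ^ 2 := by
      intro t ht
      rw [hgn, Pi.single_zero, add_zero, hεsq]
      refine (ih β' hβ'S _).trans ?_
      have hnorm : ‖x‖ ≤ ‖x + (σ * t) • e‖ :=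
        norm_le_norm_add_smul_single x i (by nlinarith)
      have : ‖x‖ ^ (1 / s) ≤ ‖x + (σ * t) • e‖ ^ (1 / s) :=
        Real.rpow_le_rpow (norm_nonneg _) hnorm (by positivity)
      rw [hQ']
      refine mul_le_mul_of_nonneg_left (Real.exp_le_exp.2 ?_) (by positivity)
      have h2 : 0 ≤ A / 2 ^ c := by positivity
      nlinarith
    have hg2 : ∀ t, 0 ≤ t →
        ‖g (2 * k) t‖ ≤ Q' * H ^ (2 * k) * ((2 * k).factorial : ℝ) ^ s := by
      intro t _
      rw [hgn]
      refine (hβ _ _).trans ?_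
      rw [mlen_add_single, mfact_add_single _ _ hβ'i, pow_add, Nat.cast_mul,
        Real.mul_rpow (by positivity) (by positivity), hQ']
      have e1 : Q ≤ 2 ^ c * Q := le_mul_of_one_le_left hQ (one_le_pow₀ (by norm_num))
      have e2 : H ≤ gevreyLoss s * H := le_mul_of_one_le_left hH.le hL
      calc _ = Q * H ^ mlen β' * (mfact β' : ℝ) ^ s * H ^ (2 * k) *
              ((2 * k).factorial : ℝ) ^ s := by ring
        _ ≤ _ := by gcongr
    have key := norm_deriv_le_of_decay_of_gevrey hs hH hQ'0 (Real.exp_pos _) hε1 k g hg hg0 hg2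
    rw [hgn, mul_zero, zero_smul, add_zero, ← hdecomp] at key
    refine key.trans (le_of_eq ?_)
    rw [Finset.card_insert_of_notMem hi, ← hc, ← hε, hQ']
    have hm : mlen β = mlen β' + k := by
      conv_lhs => rw [hdecomp]
      exact mlen_add_single _ _ _
    have hf : mfact β = mfact β' * k.factorial := by
      conv_lhs => rw [hdecomp]
      exact mfact_add_single _ _ hβ'i _
    rw [hm, hf, Nat.cast_mul, Real.mul_rpow (by positivity) (by positivity)]
    ring

end CoordinatewiseDecay

section FourierFamily

lemma pow_mul_exp_neg_rpow_le {s c t : ℝ} (hs : 0 < s) (hc : 0 < c) (ht : 0 ≤ t) (a : ℕ) :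
    t ^ a * Real.exp (-c * t ^ (1 / s)) ≤ ((s / c) ^ s) ^ a * (a.factorial : ℝ) ^ s := by
  set y : ℝ := c / s * t ^ (1 / s) with hy
  have hy0 : 0 ≤ y := by positivity
  have h1 : y ^ a ≤ a.factorial * Real.exp y := by
    rw [← div_le_iff₀' (by positivity)]
    exact Real.pow_div_factorial_le_exp y hy0 a
  have h2 := Real.rpow_le_rpow (by positivity) h1 hs.le
  rw [Real.mul_rpow (by positivity) (Real.exp_pos _).le, ← Real.exp_mul] at h2
  have h3 : y * s = c * t ^ (1 / s) := by rw [hy]; field_simp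
  have h4 : (y ^ a) ^ s = ((c / s) ^ s) ^ a * t ^ a := by
    rw [← Real.rpow_natCast, ← Real.rpow_mul hy0, mul_comm, Real.rpow_mul hy0, hy,
      Real.mul_rpow (by positivity) (by positivity), ← Real.rpow_mul ht,
      one_div_mul_cancel hs.ne', Real.rpow_one, Real.rpow_natCast, mul_pow]
  have h5 : (s / c) ^ s * (c / s) ^ s = 1 := by
    rw [← Real.mul_rpow (by positivity) (by positivity)]
    have : s / c * (c / s) = 1 := by field_simp
    rw [this, Real.one_rpow]
  rw [h3, h4] at h2
  have h6 : Real.exp (c * t ^ (1 / s)) * Real.exp (-c * t ^ (1 / s)) = 1 := by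
    rw [← Real.exp_add, ← Real.exp_zero]; congr 1; ring
  calc t ^ a * Real.exp (-c * t ^ (1 / s))
      = ((s / c) ^ s * (c / s) ^ s) ^ a * (t ^ a * Real.exp (-c * t ^ (1 / s))) := by
        rw [h5, one_pow, one_mul]
    _ = ((s / c) ^ s) ^ a * (((c / s) ^ s) ^ a * t ^ a) * Real.exp (-c * t ^ (1 / s)) := by
        rw [mul_pow]; ring
    _ ≤ ((s / c) ^ s) ^ a * ((a.factorial : ℝ) ^ s * Real.exp (c * t ^ (1 / s))) *
        Real.exp (-c * t ^ (1 / s)) := by gcongr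
    _ = ((s / c) ^ s) ^ a * (a.factorial : ℝ) ^ s *
        (Real.exp (c * t ^ (1 / s)) * Real.exp (-c * t ^ (1 / s))) := by ring
    _ = _ := by rw [h6, mul_one]

variable {d : ℕ}

lemma abs_mpow_mul_exp_neg_rpow_le {s c : ℝ} (hs : 0 < s) (hc : 0 < c) (y : Ed d)
    (α : Fin d → ℕ) :
    |mpow y α| * Real.exp (-(d * c) * ‖y‖ ^ (1 / s)) ≤
      ((s / c) ^ s) ^ mlen α * (mfact α : ℝ) ^ s := by
  have h1 : Real.exp (-(d * c) * ‖y‖ ^ (1 / s)) = ∏ _j : Fin d, Real.exp (-c * ‖y‖ ^ (1 / s)) := by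
    rw [Finset.prod_const, ← Real.exp_nat_mul, Finset.card_univ, Fintype.card_fin]
    congr 1; ring
  have h2 : ((s / c) ^ s) ^ mlen α * (mfact α : ℝ) ^ s =
      ∏ j, (((s / c) ^ s) ^ α j * ((α j).factorial : ℝ) ^ s) := by
    rw [Finset.prod_mul_distrib, Finset.prod_pow_eq_pow_sum,
      Real.finsetProd_rpow _ _ (fun _ _ => by positivity)]
    simp [mlen, mfact]
  rw [h1, h2, mpow, Finset.abs_prod, ← Finset.prod_mul_distrib]
  refine Finset.prod_le_prod (fun _ _ => by positivity) fun j _ => ?_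
  rw [abs_pow]
  refine le_trans ?_ (pow_mul_exp_neg_rpow_le hs hc (abs_nonneg (y j)) (α j))
  have h3 : |y j| ≤ ‖y‖ := by simpa using PiLp.norm_apply_le y j
  have h4 : |y j| ^ (1 / s) ≤ ‖y‖ ^ (1 / s) := Real.rpow_le_rpow (abs_nonneg _) h3 (by positivity)
  gcongr ?_ * Real.exp ?_
  nlinarith

lemma integrable_exp_neg_mul_norm_rpow {s b : ℝ} (hs : 0 < s) (hb : 0 < b) :
    Integrable (fun x : Ed d => Real.exp (-b * ‖x‖ ^ (1 / s))) := by
  have hint : Integrable (fun x : Ed d => (1 + ‖x‖) ^ (-((d + 1 : ℕ) : ℝ))) :=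
    integrable_one_add_norm (by simp)
  set K : ℝ := ((s / b) ^ s) ^ (d + 1) * ((d + 1).factorial : ℝ) ^ s with hK
  refine (hint.const_mul (2 ^ d * (1 + K))).mono' ?_ (Filter.Eventually.of_forall fun x => ?_)
  · refine Measurable.aestronglyMeasurable ?_
    fun_prop
  · have hx := norm_nonneg x
    rw [Real.norm_of_nonneg (Real.exp_pos _).le, Real.rpow_neg (by positivity), Real.rpow_natCast,
      ← div_eq_mul_inv, le_div_iff₀ (by positivity)]
    have h1 := pow_mul_exp_neg_rpow_le hs hb hx (d + 1)
    have h2 : (1 + ‖x‖) ^ (d + 1) ≤ 2 ^ d * (1 ^ (d + 1) + ‖x‖ ^ (d + 1)) :=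
      add_pow_le zero_le_one hx (d + 1)
    have h3 : Real.exp (-b * ‖x‖ ^ (1 / s)) ≤ 1 := by
      rw [Real.exp_le_one_iff, neg_mul, neg_nonpos]
      positivity
    rw [one_pow] at h2
    calc _ ≤ Real.exp (-b * ‖x‖ ^ (1 / s)) * (2 ^ d * (1 + ‖x‖ ^ (d + 1))) := by gcongr
      _ = 2 ^ d * (Real.exp (-b * ‖x‖ ^ (1 / s)) +
          ‖x‖ ^ (d + 1) * Real.exp (-b * ‖x‖ ^ (1 / s))) := by ring
      _ ≤ _ := by gcongr

open Real in
/-- The density whose Fourier transform is the `β`-th partial derivative of the Fourier transform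
of `G`. -/
def fourierDerivDensity (G : Ed d → ℂ) (β : Fin d → ℕ) (ξ : Ed d) : ℂ :=
  (∏ j, (-(2 * π * Complex.I) * (ξ j : ℂ)) ^ β j) * G ξ

lemma norm_fourierDerivDensity (G : Ed d → ℂ) (β : Fin d → ℕ) (ξ : Ed d) :
    ‖fourierDerivDensity G β ξ‖ = |mpow ((2 * Real.pi) • ξ) β| * ‖G ξ‖ := by
  rw [fourierDerivDensity, norm_mul, norm_prod, mpow, Finset.abs_prod]
  congr 1
  refine Finset.prod_congr rfl fun j _ => ?_
  rw [norm_pow, abs_pow]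
  congr 1
  simp [abs_mul]

lemma fourierDerivDensity_zero (G : Ed d → ℂ) : fourierDerivDensity G 0 = G := by
  funext ξ
  simp [fourierDerivDensity]

lemma fourierDerivDensity_add_single (G : Ed d → ℂ) (β : Fin d → ℕ) (i : Fin d) (ξ : Ed d) :
    fourierDerivDensity G (β + Pi.single i 1) ξ =
      -(2 * Real.pi * Complex.I) * (ξ i : ℂ) * fourierDerivDensity G β ξ := by
  have h : ∀ j, (-(2 * Real.pi * Complex.I) * (ξ j : ℂ)) ^ ((β + Pi.single i 1 : Fin d → ℕ) j) =
      (if j = i then -(2 * Real.pi * Complex.I) * (ξ j : ℂ) else 1) *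
        (-(2 * Real.pi * Complex.I) * (ξ j : ℂ)) ^ β j := by
    intro j
    by_cases hj : j = i
    · subst hj; simp [pow_succ, mul_comm]
    · simp [hj]
  simp only [fourierDerivDensity]
  rw [Finset.prod_congr rfl fun j _ => h j, Finset.prod_mul_distrib, Finset.prod_ite_eq']
  simp [mul_assoc]

lemma aestronglyMeasurable_fourierDerivDensity {G : Ed d → ℂ}
    (hG : AEStronglyMeasurable G) (β : Fin d → ℕ) :
    AEStronglyMeasurable (fourierDerivDensity G β) := by
  refine AEStronglyMeasurable.mul (Continuous.aestronglyMeasurable ?_) hG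
  fun_prop

/-- Moments of a function with stretched exponential decay are integrable. -/
lemma integrable_norm_pow_mul_of_decay {s b N : ℝ} (hs : 0 < s) (hb : 0 < b) {G : Ed d → ℂ}
    (hG : AEStronglyMeasurable G) (hGb : ∀ ξ, ‖G ξ‖ ≤ N * Real.exp (-b * ‖ξ‖ ^ (1 / s)))
    (m : ℕ) : Integrable (fun ξ : Ed d => ‖ξ‖ ^ m * ‖G ξ‖) := by
  have hint := integrable_exp_neg_mul_norm_rpow (d := d) hs (half_pos hb)
  set K : ℝ := ((s / (b / 2)) ^ s) ^ m * (m.factorial : ℝ) ^ s with hK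
  refine (hint.const_mul (|N| * K)).mono' ?_ (Filter.Eventually.of_forall fun x => ?_)
  · exact (Continuous.aestronglyMeasurable (by fun_prop)).mul hG.norm
  · have h1 := pow_mul_exp_neg_rpow_le hs (half_pos hb) (norm_nonneg x) m
    have h2 : Real.exp (-b * ‖x‖ ^ (1 / s)) =
        Real.exp (-(b / 2) * ‖x‖ ^ (1 / s)) * Real.exp (-(b / 2) * ‖x‖ ^ (1 / s)) := by
      rw [← Real.exp_add]; congr 1; ring
    rw [Real.norm_of_nonneg (by positivity)]
    calc _ ≤ ‖x‖ ^ m * (|N| * Real.exp (-b * ‖x‖ ^ (1 / s))) := by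
          gcongr
          exact (hGb x).trans (by gcongr; exact le_abs_self N)
      _ = |N| * (‖x‖ ^ m * Real.exp (-(b / 2) * ‖x‖ ^ (1 / s))) *
          Real.exp (-(b / 2) * ‖x‖ ^ (1 / s)) := by rw [h2]; ring
      _ ≤ _ := by gcongr

lemma abs_mpow_le (y : Ed d) (β : Fin d → ℕ) : |mpow y β| ≤ ‖y‖ ^ mlen β := by
  rw [mpow, mlen, ← Finset.prod_pow_eq_pow_sum, Finset.abs_prod]
  refine Finset.prod_le_prod (fun _ _ => abs_nonneg _) fun j _ => ?_
  rw [abs_pow]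
  exact pow_le_pow_left₀ (abs_nonneg _) (by simpa using PiLp.norm_apply_le y j) _

lemma integrable_norm_pow_mul_fourierDerivDensity {G : Ed d → ℂ}
    (hG : AEStronglyMeasurable G)
    (hint : ∀ m : ℕ, Integrable (fun ξ : Ed d => ‖ξ‖ ^ m * ‖G ξ‖)) (β : Fin d → ℕ) (m : ℕ) :
    Integrable (fun ξ : Ed d => ‖ξ‖ ^ m * ‖fourierDerivDensity G β ξ‖) := by
  refine ((hint (m + mlen β)).const_mul ((2 * Real.pi) ^ mlen β)).mono' ?_
    (Filter.Eventually.of_forall fun x => ?_)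
  · exact (Continuous.aestronglyMeasurable (by fun_prop)).mul
      (aestronglyMeasurable_fourierDerivDensity hG β).norm
  · rw [Real.norm_of_nonneg (by positivity), norm_fourierDerivDensity]
    have h1 := abs_mpow_le ((2 * Real.pi) • x) β
    rw [norm_smul, Real.norm_of_nonneg (by positivity), mul_pow] at h1
    calc _ ≤ ‖x‖ ^ m * ((2 * Real.pi) ^ mlen β * ‖x‖ ^ mlen β * ‖G x‖) := by gcongr
      _ = _ := by rw [pow_add]; ring

open FourierTransform

lemma hasFDerivAt_fourier_fourierDerivDensity {G : Ed d → ℂ}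
    (hG : AEStronglyMeasurable G)
    (hint : ∀ m : ℕ, Integrable (fun ξ : Ed d => ‖ξ‖ ^ m * ‖G ξ‖)) (β : Fin d → ℕ) (x : Ed d) :
    ∃ L : Ed d →L[ℝ] ℂ, HasFDerivAt (𝓕 (fourierDerivDensity G β)) L x ∧
      ∀ i, L (EuclideanSpace.single i 1) = 𝓕 (fourierDerivDensity G (β + Pi.single i 1)) x := by
  have hm := integrable_norm_pow_mul_fourierDerivDensity hG hint β
  have hmeas := aestronglyMeasurable_fourierDerivDensity hG β
  have h0 : Integrable (fourierDerivDensity G β) :=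
    (integrable_norm_iff hmeas).1 (by simpa using hm 0)
  have h1 : Integrable (fun v => ‖v‖ * ‖fourierDerivDensity G β v‖) := by simpa using hm 1
  refine ⟨_, Real.hasFDerivAt_fourier h0 h1 x, fun i => ?_⟩
  have hI : Integrable (VectorFourier.fourierSMulRight (innerSL ℝ) (fourierDerivDensity G β)) := by
    refine (h1.const_mul (2 * Real.pi * ‖innerSL ℝ (E := Ed d)‖)).mono'
      hmeas.fourierSMulRight (Filter.Eventually.of_forall fun v => ?_)
    refine (VectorFourier.norm_fourierSMulRight_le _ _ _).trans (le_of_eq ?_)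
    ring
  rw [Real.fourier_continuousLinearMap_apply hI]
  refine congrFun (congrArg _ (funext fun ξ => ?_)) x
  rw [fourierDerivDensity_add_single, VectorFourier.fourierSMulRight_apply]
  have hinner : (innerSL ℝ ξ) (EuclideanSpace.single i (1 : ℝ)) = ξ i := by
    simp [innerSL_apply_apply, EuclideanSpace.inner_single_right]
  rw [hinner]
  simp only [Complex.real_smul, smul_eq_mul]
  ring

lemma hasDerivAt_fourier_fourierDerivDensity {G : Ed d → ℂ}
    (hG : AEStronglyMeasurable G)
    (hint : ∀ m : ℕ, Integrable (fun ξ : Ed d => ‖ξ‖ ^ m * ‖G ξ‖)) (β : Fin d → ℕ) (i : Fin d)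
    (x : Ed d) (t : ℝ) :
    HasDerivAt
      (fun t : ℝ => 𝓕 (fourierDerivDensity G β) (x + t • (EuclideanSpace.single i (1 : ℝ) : Ed d)))
      (𝓕 (fourierDerivDensity G (β + Pi.single i 1))
        (x + t • (EuclideanSpace.single i (1 : ℝ) : Ed d))) t := by
  obtain ⟨L, hL, hLi⟩ := hasFDerivAt_fourier_fourierDerivDensity hG hint β
    (x + t • (EuclideanSpace.single i (1 : ℝ) : Ed d))
  rw [← hLi]
  refine hL.comp_hasDerivAt t ?_
  simpa using ((hasDerivAt_id t).smul_const (EuclideanSpace.single i (1 : ℝ) : Ed d)).const_add x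

lemma mderiv_fourier {G : Ed d → ℂ} (hG : AEStronglyMeasurable G)
    (hint : ∀ m : ℕ, Integrable (fun ξ : Ed d => ‖ξ‖ ^ m * ‖G ξ‖)) (β : Fin d → ℕ) :
    mderiv β (𝓕 G) = 𝓕 (fourierDerivDensity G β) := by
  have hpd : ∀ (i : Fin d) (γ : Fin d → ℕ), pdGS i (𝓕 (fourierDerivDensity G γ)) =
      𝓕 (fourierDerivDensity G (γ + Pi.single i 1)) := by
    intro i γ
    funext x
    obtain ⟨L, hL, hLi⟩ := hasFDerivAt_fourier_fourierDerivDensity hG hint γ x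
    rw [pdGS, hL.fderiv, hLi]
  have hiter : ∀ (i : Fin d) (k : ℕ) (γ : Fin d → ℕ),
      (pdGS i)^[k] (𝓕 (fourierDerivDensity G γ)) =
        𝓕 (fourierDerivDensity G (Pi.single i k + γ)) := by
    intro i k γ
    induction k with
    | zero => simp
    | succ k ih =>
      rw [Function.iterate_succ_apply', ih, hpd, Pi.single_add, add_right_comm]
  have hlist : ∀ l : List (Fin d),
      ((l.map fun i => (pdGS i)^[β i]).foldr (· ∘ ·) id) (𝓕 G) =
        𝓕 (fourierDerivDensity G (l.map fun i => Pi.single i (β i)).sum) := by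
    intro l
    induction l with
    | nil => simp [fourierDerivDensity_zero]
    | cons i l ih =>
      simp only [List.map_cons, List.foldr_cons, Function.comp_apply, List.sum_cons]
      rw [ih, hiter]
  rw [mderiv, List.ofFn_eq_map, hlist, ← List.ofFn_eq_map, List.sum_ofFn,
    Finset.univ_sum_single]

lemma norm_fourier_fourierDerivDensity_le {s c M : ℝ} (hs : 0 < s) (hc : 0 < c) (hd : 0 < d)
    (hM : 0 ≤ M) {G : Ed d → ℂ}
    (hGb : ∀ ξ, ‖G ξ‖ ≤ M * Real.exp (-(2 * (d * c)) * ‖(2 * Real.pi) • ξ‖ ^ (1 / s)))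
    (β : Fin d → ℕ) (x : Ed d) :
    ‖𝓕 (fourierDerivDensity G β) x‖ ≤
      M * (∫ ξ : Ed d, Real.exp (-(d * c) * ‖(2 * Real.pi) • ξ‖ ^ (1 / s))) *
        ((s / c) ^ s) ^ mlen β * (mfact β : ℝ) ^ s := by
  have hdc : 0 < d * c := by positivity
  have hint : Integrable
      fun ξ : Ed d => Real.exp (-(d * c) * ‖(2 * Real.pi) • ξ‖ ^ (1 / s)) :=
    (integrable_exp_neg_mul_norm_rpow hs hdc).comp_smul (by positivity)
  have hpt : ∀ ξ, ‖fourierDerivDensity G β ξ‖ ≤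
      M * ((s / c) ^ s) ^ mlen β * (mfact β : ℝ) ^ s *
        Real.exp (-(d * c) * ‖(2 * Real.pi) • ξ‖ ^ (1 / s)) := by
    intro ξ
    rw [norm_fourierDerivDensity]
    set y := (2 * Real.pi) • ξ with hy
    have h1 := abs_mpow_mul_exp_neg_rpow_le hs hc y β
    have h2 : Real.exp (-(2 * (d * c)) * ‖y‖ ^ (1 / s)) =
        Real.exp (-(d * c) * ‖y‖ ^ (1 / s)) * Real.exp (-(d * c) * ‖y‖ ^ (1 / s)) := by
      rw [← Real.exp_add]; congr 1; ring
    calc _ ≤ |mpow y β| * (M * Real.exp (-(2 * (d * c)) * ‖y‖ ^ (1 / s))) := by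
          gcongr; exact hGb ξ
      _ = M * (|mpow y β| * Real.exp (-(d * c) * ‖y‖ ^ (1 / s))) *
          Real.exp (-(d * c) * ‖y‖ ^ (1 / s)) := by rw [h2]; ring
      _ ≤ M * (((s / c) ^ s) ^ mlen β * (mfact β : ℝ) ^ s) *
          Real.exp (-(d * c) * ‖y‖ ^ (1 / s)) := by gcongr
      _ = _ := by ring
  have h1 : ‖𝓕 (fourierDerivDensity G β) x‖ ≤ ∫ ξ, ‖fourierDerivDensity G β ξ‖ :=
    VectorFourier.norm_fourierIntegral_le_integral_norm _ _ _ _ _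
  refine h1.trans ((integral_mono_of_nonneg (Filter.Eventually.of_forall fun _ => norm_nonneg _)
    (hint.const_mul _) (Filter.Eventually.of_forall hpt)).trans (le_of_eq ?_))
  rw [integral_const_mul]
  ring

lemma fourier_eq_FTgs (f : Ed d → ℂ) (ξ : Ed d) :
    𝓕 f ξ = FTgs f ((2 * Real.pi) • ξ) := by
  rw [Real.fourier_eq', FTgs]
  congr 1
  funext x
  rw [inner_smul_right, smul_eq_mul, mul_comm]
  congr 2
  push_cast
  ring

lemma exists_pos_div_rpow_eq {s h : ℝ} (hs : 0 < s) (hh : 0 < h) : ∃ c, 0 < c ∧ (s / c) ^ s = h := by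
  refine ⟨s / h ^ (1 / s), by positivity, ?_⟩
  rw [div_div_cancel₀ hs.ne', ← Real.rpow_mul hh.le, one_div_mul_cancel hs.ne', Real.rpow_one]

lemma abs_mpow_mul_norm_mderiv_le {d : ℕ} (hd : 0 < d) {s a b M : ℝ} (hs : 0 < s)
    (ha : 0 < a) (hb : 0 < b) (hM : 0 ≤ M) {f : Ed d → ℂ} (hf : Continuous f)
    (hfb : ∀ x, ‖f x‖ ≤ M * Real.exp (-(2 ^ d * (d * a)) * ‖x‖ ^ (1 / s)))
    (hFb : ∀ ξ, ‖FTgs f ξ‖ ≤ M * Real.exp (-(2 * (d * b)) * ‖ξ‖ ^ (1 / s)))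
    (x : Ed d) (α β : Fin d → ℕ) :
    |mpow x α| * ‖mderiv β f x‖ ≤
      2 ^ d * (M * (1 + ∫ ξ : Ed d, Real.exp (-(d * b) * ‖(2 * Real.pi) • ξ‖ ^ (1 / s)))) *
        ((s / a) ^ s) ^ mlen α * (gevreyLoss s * (s / b) ^ s) ^ mlen β *
          ((mfact α : ℝ) * (mfact β : ℝ)) ^ s := by
  have hdb : 0 < d * b := by positivity
  have hda : 0 < d * a := by positivity
  have hpi : 0 < 2 * Real.pi := by positivity
  set K : ℝ := ∫ ξ : Ed d, Real.exp (-(d * b) * ‖(2 * Real.pi) • ξ‖ ^ (1 / s)) with hK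
  have hK0 : 0 ≤ K := integral_nonneg fun _ => (Real.exp_pos _).le
  have hfint : Integrable f :=
    ((integrable_exp_neg_mul_norm_rpow hs (by positivity : 0 < 2 ^ d * (d * a))).const_mul M).mono'
      hf.aestronglyMeasurable (Filter.Eventually.of_forall hfb)
  have hFcont : Continuous (𝓕 f) :=
    VectorFourier.fourierIntegral_continuous Real.continuous_fourierChar
      (by exact continuous_inner) hfint
  let G : Ed d → ℂ := fun ξ => 𝓕 f (-ξ)
  have hGcont : Continuous G := hFcont.comp continuous_neg
  have hGb : ∀ ξ, ‖G ξ‖ ≤ M * Real.exp (-(2 * (d * b)) * ‖(2 * Real.pi) • ξ‖ ^ (1 / s)) := by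
    intro ξ
    have h1 := hFb ((2 * Real.pi) • (-ξ))
    rw [smul_neg, norm_neg] at h1
    simpa only [G, fourier_eq_FTgs, smul_neg] using h1
  have hGb' : ∀ ξ, ‖G ξ‖ ≤
      M * Real.exp (-(2 * (d * b) * (2 * Real.pi) ^ (1 / s)) * ‖ξ‖ ^ (1 / s)) := by
    intro ξ
    refine (hGb ξ).trans (le_of_eq ?_)
    rw [norm_smul, Real.norm_of_nonneg hpi.le, Real.mul_rpow hpi.le (norm_nonneg _)]
    ring_nf
  have hmom := integrable_norm_pow_mul_of_decay hs (by positivity) hGcont.aestronglyMeasurable hGb'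
  have hGint : Integrable G :=
    (integrable_norm_iff hGcont.aestronglyMeasurable).1 (by simpa using hmom 0)
  have hFint : Integrable (𝓕 f) := by simpa [G] using hGint.comp_neg
  have hfG : f = 𝓕 G := by
    rw [← hf.fourierInv_fourier_eq hfint hFint, Real.fourierInv_eq_fourier_comp_neg]
  have hQ0 : 0 ≤ M * (1 + K) := by positivity
  have hH : 0 < (s / b) ^ s := by positivity
  have key := norm_le_of_decay_of_gevrey (A := 2 ^ d * (d * a)) hs hH hQ0 (by positivity)
    (fun β => 𝓕 (fourierDerivDensity G β))
    (fun β i x t => hasDerivAt_fourier_fourierDerivDensity hGcont.aestronglyMeasurable hmom β i x t)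
    (fun x => by
      rw [fourierDerivDensity_zero, ← hfG]
      refine (hfb x).trans ?_
      gcongr
      nlinarith)
    (fun β x => by
      refine (norm_fourier_fourierDerivDensity_le hs hb hd hM hGb β x).trans ?_
      gcongr
      linarith)
    Finset.univ β (fun i hi => absurd (Finset.mem_univ i) hi) x
  rw [← mderiv_fourier hGcont.aestronglyMeasurable hmom, ← hfG, Finset.card_univ, Fintype.card_fin,
    mul_div_cancel_left₀ _ (by positivity : (2 : ℝ) ^ d ≠ 0)] at key
  have hα := abs_mpow_mul_exp_neg_rpow_le hs ha x α
  have hL : 0 < gevreyLoss s := zero_lt_one.trans_le (one_le_gevreyLoss hs)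
  calc _ ≤ |mpow x α| * (2 ^ d * (M * (1 + K)) * (gevreyLoss s * (s / b) ^ s) ^ mlen β *
        (mfact β : ℝ) ^ s * Real.exp (-(d * a) * ‖x‖ ^ (1 / s))) := by gcongr
    _ = 2 ^ d * (M * (1 + K)) * (gevreyLoss s * (s / b) ^ s) ^ mlen β * (mfact β : ℝ) ^ s *
        (|mpow x α| * Real.exp (-(d * a) * ‖x‖ ^ (1 / s))) := by ring
    _ ≤ 2 ^ d * (M * (1 + K)) * (gevreyLoss s * (s / b) ^ s) ^ mlen β * (mfact β : ℝ) ^ s *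
        (((s / a) ^ s) ^ mlen α * (mfact α : ℝ) ^ s) := by gcongr
    _ = _ := by
        rw [Real.mul_rpow (by positivity) (by positivity)]
        ring

lemma le_mul_exp_neg_of_iSup_le {E : Type*} {φ w : E → ℝ} {T : ℝ≥0∞} (hT : T ≠ ⊤)
    (hφ : ⨆ x, ENNReal.ofReal (Real.exp (w x) * φ x) ≤ T) (x : E) :
    φ x ≤ T.toReal * Real.exp (-w x) := by
  have h1 : Real.exp (w x) * φ x ≤ T.toReal :=
    (ENNReal.ofReal_le_iff_le_toReal hT).1 ((le_iSup (fun x => ENNReal.ofReal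
      (Real.exp (w x) * φ x)) x).trans hφ)
  rw [Real.exp_neg, ← div_eq_mul_inv, le_div_iff₀ (Real.exp_pos _), mul_comm]
  exact h1

end FourierFamily


theorem statement1 (d : ℕ) (hd : 1 ≤ d) (s : ℝ) (hs : 1/2 < s)
    (h : ℝ) (hh : 0 < h) :
    ∃ A B C : ℝ, 0 < A ∧ 0 < B ∧ 0 < C ∧ ∀ f ∈ SigmaGS s d,
      GSnorm s h f ≤ ENNReal.ofReal C *
        ((⨆ x : Ed d, ENNReal.ofReal (Real.exp (A * ‖x‖ ^ (1/s)) * ‖f x‖))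
          + (⨆ ξ : Ed d, ENNReal.ofReal (Real.exp (B * ‖ξ‖ ^ (1/s)) * ‖FTgs f ξ‖))) := by
  have hs0 : 0 < s := by linarith
  have hd0 : 0 < d := hd
  have hL : 0 < gevreyLoss s := zero_lt_one.trans_le (one_le_gevreyLoss hs0)
  obtain ⟨a, ha, hah⟩ := exists_pos_div_rpow_eq hs0 hh
  obtain ⟨b, hb, hbh⟩ := exists_pos_div_rpow_eq hs0 (div_pos hh hL)
  set K : ℝ := ∫ ξ : Ed d, Real.exp (-(d * b) * ‖(2 * Real.pi) • ξ‖ ^ (1 / s)) with hK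
  have hK0 : 0 ≤ K := integral_nonneg fun _ => (Real.exp_pos _).le
  have hC : 0 < 2 ^ d * (1 + K) := by positivity
  refine ⟨2 ^ d * (d * a), 2 * (d * b), 2 ^ d * (1 + K), by positivity, by positivity, hC,
    fun f hf => ?_⟩
  set T₁ := ⨆ x : Ed d, ENNReal.ofReal (Real.exp (2 ^ d * (d * a) * ‖x‖ ^ (1 / s)) * ‖f x‖)
  set T₂ := ⨆ ξ : Ed d, ENNReal.ofReal (Real.exp (2 * (d * b) * ‖ξ‖ ^ (1 / s)) * ‖FTgs f ξ‖)
  by_cases hT : T₁ + T₂ = ⊤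
  · rw [hT, ENNReal.mul_top (by simpa using hC)]
    exact le_top
  rw [← ENNReal.ofReal_toReal hT, ← ENNReal.ofReal_mul hC.le]
  have hfb := le_mul_exp_neg_of_iSup_le hT (le_self_add : T₁ ≤ T₁ + T₂)
  have hFb := le_mul_exp_neg_of_iSup_le hT (le_add_self : T₂ ≤ T₁ + T₂)
  simp only [← neg_mul] at hfb hFb
  refine iSup_le fun x => iSup_le fun α => iSup_le fun β => ENNReal.ofReal_le_ofReal ?_
  have key := abs_mpow_mul_norm_mderiv_le hd0 hs0 ha hb ENNReal.toReal_nonneg hf.1.continuous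
    (by simpa only [neg_mul] using hfb) (by simpa only [neg_mul] using hFb) x α β
  rw [hah, hbh, mul_div_cancel₀ _ hL.ne', ← hK] at key
  have hmα : (0 : ℝ) < mfact α := by
    exact_mod_cast Finset.prod_pos fun i _ => Nat.factorial_pos _
  have hmβ : (0 : ℝ) < mfact β := by
    exact_mod_cast Finset.prod_pos fun i _ => Nat.factorial_pos _
  rw [div_le_iff₀ (by positivity), pow_add]
  refine key.trans (le_of_eq ?_)
  ring


end
end

section
/- Let s > 1/2, d ≥ 1, and fix a window φ ∈ Σ_s(ℝ^d) \ {0}. For every A > 0 there exist h > 0 and C > 0 (depending on A and φ) such that for every f ∈ Σ_s(ℝ^d) one has sup_{z ∈ ℝ^{2d}} e^{A|z|^{1/s}} |V_φ f(z)| ≤ C ‖f‖_{S_{s,h}}. -/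
open MeasureTheory Filter
open scoped BigOperators ENNReal RealInnerProductSpace

noncomputable section

lemma foldr_comp_ofFn_eq {X : Type*} {n : ℕ} (g : Fin n → X → X) (j : Fin n)
    (hg : ∀ i, i ≠ j → g i = id) : (List.ofFn g).foldr (· ∘ ·) id = g j := by
  induction n with
  | zero => exact j.elim0
  | succ n ih =>
    rw [List.ofFn_succ, List.foldr_cons]
    induction j using Fin.cases with
    | zero =>
      have hid : ∀ l : List (X → X), (∀ f ∈ l, f = id) → l.foldr (· ∘ ·) id = id := by
        intro l hl
        induction l with
        | nil => rfl
        | cons a l ihl =>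
          rw [List.foldr_cons, hl a (by simp), ihl fun f hf => hl f (by simp [hf])]
          rfl
      rw [hid _ fun f hf => ?_]
      · rfl
      · obtain ⟨i, rfl⟩ := List.mem_ofFn.1 hf
        exact hg _ (Fin.succ_ne_zero i)
    | succ j =>
      rw [hg 0 (Fin.succ_ne_zero j).symm, ih (fun i => g i.succ) j]
      · rfl
      · exact fun i hi => hg _ fun h => hi (Fin.succ_injective _ h)

lemma mderiv_single {d : ℕ} (j : Fin d) (l : ℕ) (f : Ed d → ℂ) :
    mderiv (Pi.single j l) f = (pdGS j)^[l] f := by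
  unfold mderiv
  rw [foldr_comp_ofFn_eq _ j]
  · simp
  · intro i hi
    simp [Pi.single_eq_of_ne hi]

lemma mpow_single {d : ℕ} (j : Fin d) (k : ℕ) (x : Ed d) :
    mpow x (Pi.single j k) = x j ^ k := by
  unfold mpow
  rw [Finset.prod_eq_single j (fun i _ hi => by simp [Pi.single_eq_of_ne hi]) (by simp)]
  simp

lemma mfact_single {d : ℕ} (j : Fin d) (k : ℕ) :
    mfact (Pi.single j k : Fin d → ℕ) = k.factorial := by
  unfold mfact
  rw [Finset.prod_eq_single j (fun i _ hi => by simp [Pi.single_eq_of_ne hi]) (by simp)]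
  simp

lemma mlen_single {d : ℕ} (j : Fin d) (k : ℕ) : mlen (Pi.single j k : Fin d → ℕ) = k := by
  simp [mlen]

lemma exists_norm_le_mul_abs_coord {d : ℕ} (hd : 1 ≤ d) (x : Ed d) :
    ∃ i, ‖x‖ ≤ d * |x i| := by
  have : Nonempty (Fin d) := ⟨⟨0, hd⟩⟩
  obtain ⟨i, hi⟩ := Finite.exists_max fun i => |x i|
  refine ⟨i, ?_⟩
  have hd' : (1 : ℝ) ≤ d := by exact_mod_cast hd
  rw [EuclideanSpace.norm_eq]
  refine Real.sqrt_le_iff.2 ⟨by positivity, ?_⟩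
  calc ∑ j, ‖x j‖ ^ 2 ≤ ∑ _j : Fin d, |x i| ^ 2 :=
        Finset.sum_le_sum fun j _ => by
          rw [Real.norm_eq_abs]; exact pow_le_pow_left₀ (abs_nonneg _) (hi j) 2
    _ = d * |x i| ^ 2 := by simp
    _ ≤ (d * |x i|) ^ 2 := by
        rw [mul_pow]
        exact mul_le_mul_of_nonneg_right (by nlinarith) (by positivity)

/-- Iterated directional derivatives of elements of `Σ_s`, weighted by powers of the norm. -/
lemma norm_pow_mul_iterate_pdGS_le {d : ℕ} (hd : 1 ≤ d) {s h : ℝ} (hh : 0 < h)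
    {f : Ed d → ℂ} (hf : GSnorm s h f < ⊤) (j : Fin d) (k l : ℕ) (x : Ed d) :
    ‖x‖ ^ k * ‖(pdGS j)^[l] f x‖ ≤
      (GSnorm s h f).toReal * (d * h) ^ (k + l) * ((k.factorial : ℝ) * l.factorial) ^ s := by
  obtain ⟨i, hi⟩ := exists_norm_le_mul_abs_coord hd x
  have hd' : (1 : ℝ) ≤ d := by exact_mod_cast hd
  have hle : ENNReal.ofReal (|x i| ^ k * ‖(pdGS j)^[l] f x‖ /
      (h ^ (k + l) * ((k.factorial : ℝ) * l.factorial) ^ s)) ≤ GSnorm s h f := by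
    have := le_iSup_of_le (f := fun x => ⨆ (α : Fin d → ℕ) (β : Fin d → ℕ),
      ENNReal.ofReal (|mpow x α| * ‖mderiv β f x‖ /
        (h ^ (mlen α + mlen β) * ((mfact α : ℝ) * (mfact β : ℝ)) ^ s))) x
      (le_iSup₂_of_le (Pi.single i k) (Pi.single j l) le_rfl)
    simp only [mderiv_single, mpow_single, mfact_single, mlen_single, abs_pow] at this
    exact this
  have hpos : 0 < h ^ (k + l) * ((k.factorial : ℝ) * l.factorial) ^ s := by positivity
  have hle' := (div_le_iff₀ hpos).1 ((ENNReal.ofReal_le_iff_le_toReal hf.ne).1 hle)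
  calc ‖x‖ ^ k * ‖(pdGS j)^[l] f x‖
      ≤ (d * |x i|) ^ k * ‖(pdGS j)^[l] f x‖ := by gcongr
    _ = d ^ k * (|x i| ^ k * ‖(pdGS j)^[l] f x‖) := by ring
    _ ≤ d ^ k * ((GSnorm s h f).toReal *
          (h ^ (k + l) * ((k.factorial : ℝ) * l.factorial) ^ s)) := by gcongr
    _ ≤ d ^ (k + l) * ((GSnorm s h f).toReal *
          (h ^ (k + l) * ((k.factorial : ℝ) * l.factorial) ^ s)) := by
        gcongr
        omega
    _ = _ := by rw [mul_pow]; ring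

lemma factorial_add_le (m n : ℕ) :
    ((m + n).factorial : ℝ) ≤ 2 ^ (m + n) * (m.factorial * n.factorial) := by
  rw [← Nat.add_choose_mul_factorial_mul_factorial, Nat.cast_mul, Nat.cast_mul, mul_assoc]
  gcongr
  exact_mod_cast Nat.choose_le_two_pow _ _

/-- Bound for the product of an element of `Σ_s` with a polynomial weight making it integrable. -/
lemma exists_weighted_decay {d : ℕ} (hd : 1 ≤ d) {s : ℝ} (hs : 0 < s) {φ : Ed d → ℂ}
    (hφ : φ ∈ SigmaGS s d) {η : ℝ} (hη : 0 < η) (D : ℕ) :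
    ∃ C : ℝ, 0 < C ∧ ∀ (j : Fin d) (k l : ℕ) (x : Ed d),
      ‖x‖ ^ k * ‖(pdGS j)^[l] φ x‖ ≤
        C * η ^ (k + l) * ((k.factorial : ℝ) * l.factorial) ^ s * (1 + ‖x‖) ^ (-(D : ℝ)) := by
  have hd' : (1 : ℝ) ≤ d := by exact_mod_cast hd
  have h2 : (1 : ℝ) ≤ 2 ^ s := Real.one_le_rpow one_le_two hs.le
  obtain ⟨h, hh, hdh⟩ : ∃ h : ℝ, 0 < h ∧ 2 ^ s * (d * h) = η :=
    ⟨η / (2 ^ s * d), by positivity, by field_simp⟩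
  set N := (GSnorm s h φ).toReal
  have hN : 0 ≤ N := ENNReal.toReal_nonneg
  refine ⟨2 ^ D * (N + 1) * (1 + η ^ D * (D.factorial : ℝ) ^ s), by positivity,
    fun j k l x => ?_⟩
  set F := ((k.factorial : ℝ) * l.factorial) ^ s with hF
  have hF0 : 0 ≤ F := by positivity
  have hdecay := fun k => norm_pow_mul_iterate_pdGS_le hd hh (hφ.2 h hh) j k l x
  have hle : d * h ≤ η := by
    rw [← hdh]; exact le_mul_of_one_le_left (by positivity) h2
  have h1 : ‖x‖ ^ k * ‖(pdGS j)^[l] φ x‖ ≤ (N + 1) * η ^ (k + l) * F := by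
    refine (hdecay k).trans ?_
    gcongr
    linarith
  have h3 : ‖x‖ ^ (k + D) * ‖(pdGS j)^[l] φ x‖ ≤
      (N + 1) * η ^ (k + l) * F * (η ^ D * (D.factorial : ℝ) ^ s) := by
    refine (hdecay (k + D)).trans ?_
    calc N * (d * h) ^ (k + D + l) * (((k + D).factorial : ℝ) * l.factorial) ^ s
        ≤ N * (d * h) ^ (k + D + l) *
            ((2 ^ (k + D) * (k.factorial * D.factorial)) * l.factorial) ^ s := by
          gcongr
          exact factorial_add_le k D
      _ = N * (d * h) ^ (k + D + l) * ((2 ^ s) ^ (k + D) * (F * (D.factorial : ℝ) ^ s)) := by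
          congr 1
          rw [hF, ← Real.mul_rpow (by positivity) (by positivity),
            ← Real.rpow_natCast, ← Real.rpow_natCast, ← Real.rpow_mul zero_le_two, mul_comm s,
            Real.rpow_mul zero_le_two, ← Real.mul_rpow (by positivity) (by positivity)]
          congr 1
          ring
      _ ≤ (N + 1) * (d * h) ^ (k + D + l) *
            ((2 ^ s) ^ (k + D + l) * (F * (D.factorial : ℝ) ^ s)) := by
          have := pow_le_pow_right₀ h2 (Nat.le_add_right (k + D) l)
          gcongr
          linarith
      _ = (N + 1) * (2 ^ s * (d * h)) ^ (k + D + l) * (F * (D.factorial : ℝ) ^ s) := by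
          rw [mul_pow]; ring
      _ = _ := by rw [hdh]; ring
  have hx : 0 < 1 + ‖x‖ := by positivity
  rw [Real.rpow_neg hx.le, Real.rpow_natCast, ← div_eq_mul_inv, le_div_iff₀ (by positivity)]
  have h4 : (1 + ‖x‖) ^ D ≤ 2 ^ D * (1 + ‖x‖ ^ D) := by
    have := add_pow_le zero_le_one (norm_nonneg x) D
    rw [one_pow] at this
    refine this.trans ?_
    gcongr
    · exact one_le_two
    · omega
  calc ‖x‖ ^ k * ‖(pdGS j)^[l] φ x‖ * (1 + ‖x‖) ^ D
      ≤ ‖x‖ ^ k * ‖(pdGS j)^[l] φ x‖ * (2 ^ D * (1 + ‖x‖ ^ D)) := by gcongr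
    _ = 2 ^ D * (‖x‖ ^ k * ‖(pdGS j)^[l] φ x‖ + ‖x‖ ^ (k + D) * ‖(pdGS j)^[l] φ x‖) := by ring
    _ ≤ 2 ^ D * ((N + 1) * η ^ (k + l) * F +
          (N + 1) * η ^ (k + l) * F * (η ^ D * (D.factorial : ℝ) ^ s)) := by gcongr
    _ = _ := by ring

/-- Moment bounds with constants `H ^ k * (k !) ^ s` give decay of order `exp (-B t ^ (1 / s))`. -/
lemma exp_mul_le_of_pow_mul_le {s t G M B H : ℝ} (hs : 0 < s) (ht : 0 ≤ t) (hG : 0 ≤ G)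
    (hM : 0 ≤ M) (hB : 0 ≤ B) (hH : 0 ≤ H) (hBH : B / s * H ^ (1 / s) ≤ 1 / 2)
    (h : ∀ k : ℕ, t ^ k * G ≤ M * H ^ k * (k.factorial : ℝ) ^ s) :
    Real.exp (B * t ^ (1 / s)) * G ≤ 2 ^ s * M := by
  have hterm : ∀ k : ℕ, (B / s * t ^ (1 / s)) ^ k / k.factorial * G ^ (1 / s) ≤
      (1 / 2) ^ k * M ^ (1 / s) := by
    intro k
    have hp := Real.rpow_le_rpow (by positivity) (h k) (by positivity : 0 ≤ 1 / s)
    rw [Real.mul_rpow (by positivity) hG, Real.mul_rpow (by positivity) (by positivity),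
      Real.mul_rpow hM (by positivity), ← Real.rpow_pow_comm ht, ← Real.rpow_pow_comm hH,
      ← Real.rpow_mul (by positivity), mul_one_div_cancel hs.ne', Real.rpow_one] at hp
    have hk : (0 : ℝ) < k.factorial := by positivity
    calc (B / s * t ^ (1 / s)) ^ k / k.factorial * G ^ (1 / s)
        = (B / s) ^ k / k.factorial * ((t ^ (1 / s)) ^ k * G ^ (1 / s)) := by
          rw [mul_pow]; ring
      _ ≤ (B / s) ^ k / k.factorial * (M ^ (1 / s) * (H ^ (1 / s)) ^ k * k.factorial) := by
          gcongr
      _ = (B / s * H ^ (1 / s)) ^ k * M ^ (1 / s) := by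
          rw [mul_pow]; field_simp
      _ ≤ _ := by gcongr
  have hexp : HasSum (fun k : ℕ => (B / s * t ^ (1 / s)) ^ k / k.factorial)
      (Real.exp (B / s * t ^ (1 / s))) := by
    rw [Real.exp_eq_exp_ℝ]
    exact NormedSpace.expSeries_div_hasSum_exp _
  have hsum := hasSum_le hterm (hexp.mul_right (G ^ (1 / s)))
    (hasSum_geometric_two.mul_right (M ^ (1 / s)))
  have hp := Real.rpow_le_rpow (by positivity) hsum hs.le
  rwa [Real.mul_rpow (by positivity) (by positivity), Real.mul_rpow (by positivity) (by positivity),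
    ← Real.rpow_mul hG, ← Real.rpow_mul hM, one_div_mul_cancel hs.ne', Real.rpow_one,
    Real.rpow_one, ← Real.exp_mul, show B / s * t ^ (1 / s) * s = B * t ^ (1 / s) by
      field_simp] at hp

lemma norm_cexp_neg_I_mul (t : ℝ) : ‖Complex.exp (-(Complex.I * (t : ℝ)))‖ = 1 := by
  rw [show -(Complex.I * (t : ℂ)) = ((-t : ℝ) : ℂ) * Complex.I by push_cast; ring]
  exact Complex.norm_exp_ofReal_mul_I _

lemma contDiff_pdGS {d : ℕ} (j : Fin d) {f : Ed d → ℂ}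
    (hf : ContDiff ℝ ((⊤ : ℕ∞) : WithTop ℕ∞) f) :
    ContDiff ℝ ((⊤ : ℕ∞) : WithTop ℕ∞) (pdGS j f) :=
  (hf.fderiv_right (m := ((⊤ : ℕ∞) : WithTop ℕ∞)) (by simp)).clm_apply contDiff_const

lemma contDiff_iterate_pdGS {d : ℕ} (j : Fin d) {f : Ed d → ℂ}
    (hf : ContDiff ℝ ((⊤ : ℕ∞) : WithTop ℕ∞) f) (l : ℕ) :
    ContDiff ℝ ((⊤ : ℕ∞) : WithTop ℕ∞) ((pdGS j)^[l] f) := by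
  induction l with
  | zero => exact hf
  | succ l ih => rw [Function.iterate_succ_apply']; exact contDiff_pdGS j ih

lemma integrable_stft_integrand {d : ℕ} {φ f : Ed d → ℂ} (hf : Continuous f)
    (hφ : Integrable φ) {M : ℝ} (hM : ∀ y, ‖f y‖ ≤ M) (x ξ : Ed d) :
    Integrable fun y => f y * (starRingEnd ℂ) (φ (y - x)) *
      Complex.exp (-(Complex.I * (⟪y, ξ⟫ : ℝ))) := by
  have h1 : Integrable fun y => (starRingEnd ℂ) (φ (y - x)) :=
    (LinearIsometryEquiv.integrable_comp_iff Complex.conjLIE).2 (hφ.comp_sub_right x)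
  have h2 : Integrable fun y => f y * (starRingEnd ℂ) (φ (y - x)) :=
    h1.bdd_mul hf.aestronglyMeasurable (Eventually.of_forall hM)
  refine h2.mul_bdd (c := 1) (Continuous.aestronglyMeasurable (by fun_prop))
    (Eventually.of_forall fun y => (norm_cexp_neg_I_mul _).le)

lemma norm_STFTgs_le {d : ℕ} {φ f : Ed d → ℂ}
    (hφ : Integrable φ) {M : ℝ} (hM : ∀ y, ‖f y‖ ≤ M) (z : Ed d × Ed d) :
    ‖STFTgs φ f z‖ ≤ M * ∫ y, ‖φ y‖ := by
  rw [← integral_sub_right_eq_self (fun y => ‖φ y‖) z.1, ← integral_const_mul]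
  refine norm_integral_le_of_norm_le ((hφ.comp_sub_right z.1).norm.const_mul M)
    (Eventually.of_forall fun y => ?_)
  rw [norm_mul, norm_mul, norm_cexp_neg_I_mul, mul_one, RCLike.norm_conj]
  gcongr
  exact hM y

/-- Integration by parts: multiplication by a frequency coordinate splits into derivatives of the
function and of the window. -/
lemma coord_mul_STFTgs {d : ℕ} (j : Fin d) {φ f : Ed d → ℂ}
    (hf : ContDiff ℝ ((⊤ : ℕ∞) : WithTop ℕ∞) f) (hφ : ContDiff ℝ ((⊤ : ℕ∞) : WithTop ℕ∞) φ)
    {M M' : ℝ} (hM : ∀ y, ‖f y‖ ≤ M) (hM' : ∀ y, ‖pdGS j f y‖ ≤ M')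
    (hφi : Integrable φ) (hφi' : Integrable (pdGS j φ)) (x ξ : Ed d) :
    Complex.I * (ξ j : ℂ) * STFTgs φ f (x, ξ) =
      STFTgs φ (pdGS j f) (x, ξ) + STFTgs (pdGS j φ) f (x, ξ) := by
  have hi := integrable_stft_integrand hf.continuous hφi hM x ξ
  have hi1 := integrable_stft_integrand (contDiff_pdGS j hf).continuous hφi hM' x ξ
  have hi2 := integrable_stft_integrand hf.continuous hφi' hM x ξ
  have hfd : ∀ y, DifferentiableAt ℝ f y := fun y =>
    (hf.differentiable (by simp)).differentiableAt
  have hφd : ∀ y, DifferentiableAt ℝ φ y := fun y =>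
    (hφ.differentiable (by simp)).differentiableAt
  have hψ : ∀ y, HasFDerivAt (fun y => (starRingEnd ℂ) (φ (y - x)))
      ((Complex.conjCLE : ℂ →L[ℝ] ℂ) ∘L fderiv ℝ φ (y - x)) y := fun y =>
    (Complex.conjCLE : ℂ →L[ℝ] ℂ).hasFDerivAt.comp y
      ((hasFDerivAt_comp_sub x).2 (hφd (y - x)).hasFDerivAt)
  have hu : ∀ y, fderiv ℝ (fun y => f y * (starRingEnd ℂ) (φ (y - x))) y
      (EuclideanSpace.single j 1) = pdGS j f y * (starRingEnd ℂ) (φ (y - x)) +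
        f y * (starRingEnd ℂ) (pdGS j φ (y - x)) := by
    intro y
    rw [((hfd y).hasFDerivAt.fun_mul (hψ y)).fderiv]
    simp [pdGS]
    ring
  have he : ∀ y, HasFDerivAt (fun y : Ed d => Complex.exp (-(Complex.I * (⟪y, ξ⟫ : ℝ))))
      (Complex.exp (-(Complex.I * (⟪y, ξ⟫ : ℝ))) •
        (-(Complex.I • (Complex.ofRealCLM ∘L innerSL ℝ ξ)))) y := by
    intro y
    have h1 : HasFDerivAt (fun y : Ed d => ((⟪y, ξ⟫ : ℝ) : ℂ))
        (Complex.ofRealCLM ∘L innerSL ℝ ξ) y := by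
      have := (Complex.ofRealCLM ∘L innerSL ℝ ξ).hasFDerivAt (x := y)
      refine this.congr_of_eventuallyEq (Eventually.of_forall fun y => ?_)
      simp [real_inner_comm]
    exact ((h1.const_mul Complex.I).neg).cexp
  have hev : ∀ y, fderiv ℝ (fun y : Ed d => Complex.exp (-(Complex.I * (⟪y, ξ⟫ : ℝ)))) y
      (EuclideanSpace.single j 1) =
        -(Complex.I * (ξ j : ℂ)) * Complex.exp (-(Complex.I * (⟪y, ξ⟫ : ℝ))) := by
    intro y
    rw [(he y).fderiv]
    simp [EuclideanSpace.inner_single_right]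
    ring
  have key := integral_mul_fderiv_eq_neg_fderiv_mul_of_integrable (μ := volume)
    (f := fun y => f y * (starRingEnd ℂ) (φ (y - x)))
    (g := fun y => Complex.exp (-(Complex.I * (⟪y, ξ⟫ : ℝ))))
    (v := EuclideanSpace.single j 1) ?_ ?_ hi
    (fun y _ => (hfd y).mul (hψ y).differentiableAt) (fun y _ => (he y).differentiableAt)
  · simp only [hu, hev, add_mul] at key
    rw [integral_add hi1 hi2] at key
    unfold STFTgs
    rw [← neg_eq_iff_eq_neg] at key
    rw [← key, ← integral_const_mul, ← integral_neg]
    congr 1 with y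
    ring
  · simp only [hu, add_mul]
    exact hi1.add hi2
  · simp only [hev]
    convert hi.const_mul (-(Complex.I * (ξ j : ℂ))) using 2 with y
    ring

lemma factorial_mul_factorial_rpow_le {s : ℝ} (hs : 0 ≤ s) (a b : ℕ) :
    (a.factorial : ℝ) ^ s * (b.factorial : ℝ) ^ s ≤ ((a + b).factorial : ℝ) ^ s := by
  rw [← Real.mul_rpow (by positivity) (by positivity)]
  gcongr
  exact_mod_cast Nat.le_of_dvd (Nat.factorial_pos _) (Nat.factorial_mul_factorial_dvd_factorial_add a b)

lemma abs_coord_pow_mul_STFTgs_le {d : ℕ} (j : Fin d) {φ f : Ed d → ℂ} {s η M K : ℝ}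
    (hs : 0 ≤ s) (hη : 0 ≤ η) (hM0 : 0 ≤ M)
    (hf : ContDiff ℝ ((⊤ : ℕ∞) : WithTop ℕ∞) f) (hφ : ContDiff ℝ ((⊤ : ℕ∞) : WithTop ℕ∞) φ)
    (hM : ∀ l y, ‖(pdGS j)^[l] f y‖ ≤ M * η ^ l * (l.factorial : ℝ) ^ s)
    (hφi : ∀ l, Integrable ((pdGS j)^[l] φ))
    (hK : ∀ l, ∫ y, ‖(pdGS j)^[l] φ y‖ ≤ K * η ^ l * (l.factorial : ℝ) ^ s)
    (x ξ : Ed d) (k a b : ℕ) :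
    |ξ j| ^ k * ‖STFTgs ((pdGS j)^[b] φ) ((pdGS j)^[a] f) (x, ξ)‖ ≤
      M * K * 2 ^ k * η ^ (a + b + k) * ((a + b + k).factorial : ℝ) ^ s := by
  have hK0 : 0 ≤ K := by
    have := (integral_nonneg fun y => norm_nonneg _).trans (hK 0)
    simpa using this
  induction k generalizing a b with
  | zero =>
    rw [pow_zero, one_mul, pow_zero, mul_one, add_zero]
    calc _ ≤ M * η ^ a * (a.factorial : ℝ) ^ s * ∫ y, ‖(pdGS j)^[b] φ y‖ :=
          norm_STFTgs_le (hφi b) (hM a) _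
      _ ≤ M * η ^ a * (a.factorial : ℝ) ^ s * (K * η ^ b * (b.factorial : ℝ) ^ s) := by
          gcongr
          exact hK b
      _ = M * K * η ^ (a + b) * ((a.factorial : ℝ) ^ s * (b.factorial : ℝ) ^ s) := by
          rw [pow_add]; ring
      _ ≤ _ := by
          gcongr
          exact factorial_mul_factorial_rpow_le hs a b
  | succ k ih =>
    have hM' := hM (a + 1)
    have hφ' := hφi (b + 1)
    have iha := ih (a + 1) b
    have ihb := ih a (b + 1)
    rw [Function.iterate_succ_apply'] at hM' hφ' iha ihb
    have hmul := congrArg norm (coord_mul_STFTgs j (contDiff_iterate_pdGS j hf a)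
      (contDiff_iterate_pdGS j hφ b) (hM a) hM' (hφi b) hφ' x ξ)
    rw [norm_mul, norm_mul, Complex.norm_I, one_mul, Complex.norm_real, Real.norm_eq_abs] at hmul
    rw [show a + 1 + b + k = a + b + (k + 1) by ring] at iha
    rw [show a + (b + 1) + k = a + b + (k + 1) by ring] at ihb
    calc _ = |ξ j| ^ k * (|ξ j| * ‖STFTgs ((pdGS j)^[b] φ) ((pdGS j)^[a] f) (x, ξ)‖) := by ring
      _ ≤ |ξ j| ^ k * (‖STFTgs ((pdGS j)^[b] φ) (pdGS j ((pdGS j)^[a] f)) (x, ξ)‖ +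
            ‖STFTgs (pdGS j ((pdGS j)^[b] φ)) ((pdGS j)^[a] f) (x, ξ)‖) := by
          rw [hmul]
          gcongr
          exact norm_add_le _ _
      _ ≤ _ := by
          rw [mul_add]
          refine (add_le_add iha ihb).trans_eq ?_
          ring

lemma norm_pow_mul_STFTgs_le {d : ℕ} {φ f : Ed d → ℂ} {W : Ed d → ℝ} {M K : ℝ} {k : ℕ}
    (hW : Integrable W) (hM : ∀ y, ‖f y‖ ≤ M) (hMk : ∀ y, ‖y‖ ^ k * ‖f y‖ ≤ M * K)
    (hφ : ∀ y, ‖φ y‖ ≤ W y) (hφk : ∀ y, ‖y‖ ^ k * ‖φ y‖ ≤ K * W y) (x ξ : Ed d) :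
    ‖x‖ ^ k * ‖STFTgs φ f (x, ξ)‖ ≤ 2 ^ k * (2 * M * K * ∫ y, W y) := by
  rw [← integral_sub_right_eq_self W x, ← integral_const_mul, ← integral_const_mul,
    ← Real.norm_of_nonneg (pow_nonneg (norm_nonneg x) k), ← Complex.norm_real, ← norm_mul,
    STFTgs, ← integral_const_mul]
  refine norm_integral_le_of_norm_le (((hW.comp_sub_right x).const_mul _).const_mul _)
    (Eventually.of_forall fun y => ?_)
  rw [norm_mul, norm_mul, norm_mul, norm_cexp_neg_I_mul, mul_one, RCLike.norm_conj,
    Complex.norm_real, Real.norm_of_nonneg (pow_nonneg (norm_nonneg x) k)]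
  have hx : ‖x‖ ^ k ≤ 2 ^ k * (‖y‖ ^ k + ‖y - x‖ ^ k) := by
    have h1 : ‖x‖ ≤ ‖y‖ + ‖y - x‖ := by
      simpa using norm_sub_le y (y - x)
    calc ‖x‖ ^ k ≤ (‖y‖ + ‖y - x‖) ^ k := by gcongr
      _ ≤ 2 ^ (k - 1) * (‖y‖ ^ k + ‖y - x‖ ^ k) := add_pow_le (norm_nonneg _) (norm_nonneg _) k
      _ ≤ _ := by
        gcongr
        · exact one_le_two
        · omega
  calc ‖x‖ ^ k * (‖f y‖ * ‖φ (y - x)‖)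
      ≤ 2 ^ k * (‖y‖ ^ k + ‖y - x‖ ^ k) * (‖f y‖ * ‖φ (y - x)‖) := by gcongr
    _ = 2 ^ k * ((‖y‖ ^ k * ‖f y‖) * ‖φ (y - x)‖ + ‖f y‖ * (‖y - x‖ ^ k * ‖φ (y - x)‖)) := by
        ring
    _ ≤ 2 ^ k * ((M * K) * W (y - x) + M * (K * W (y - x))) := by
        have h2 := mul_le_mul (hMk y) (hφ (y - x)) (norm_nonneg _)
          ((by positivity : (0 : ℝ) ≤ ‖y‖ ^ k * ‖f y‖).trans (hMk y))
        have h3 := mul_le_mul (hM y) (hφk (y - x)) (by positivity)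
          ((norm_nonneg _).trans (hM y))
        gcongr
    _ = _ := by ring

lemma pnorm_le_two_mul_max {d : ℕ} (z : Ed d × Ed d) : pnorm z ≤ 2 * max ‖z.1‖ ‖z.2‖ := by
  have h1 := le_max_left ‖z.1‖ ‖z.2‖
  have h2 := le_max_right ‖z.1‖ ‖z.2‖
  have h3 := norm_nonneg z.1
  have h4 := norm_nonneg z.2
  refine Real.sqrt_le_iff.2 ⟨by positivity, by nlinarith⟩

/-- Joint moment bounds for the short-time Fourier transform. -/
lemma exists_pow_max_mul_STFTgs_le {d : ℕ} (hd : 1 ≤ d) {s : ℝ} (hs : 0 < s) {φ : Ed d → ℂ}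
    (hφ : φ ∈ SigmaGS s d) {h : ℝ} (hh : 0 < h) :
    ∃ C : ℝ, 0 ≤ C ∧ ∀ f ∈ SigmaGS s d, ∀ (z : Ed d × Ed d) (k : ℕ),
      max ‖z.1‖ ‖z.2‖ ^ k * ‖STFTgs φ f z‖ ≤
        C * (GSnorm s h f).toReal * (2 * d * (d * h)) ^ k * (k.factorial : ℝ) ^ s := by
  have hd' : (1 : ℝ) ≤ d := by exact_mod_cast hd
  obtain ⟨C, hC, hφC⟩ := exists_weighted_decay hd hs hφ (η := d * h) (by positivity) (d + 1)
  have hfN := fun (f : Ed d → ℂ) (hf : f ∈ SigmaGS s d) =>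
    norm_pow_mul_iterate_pdGS_le hd hh (hf.2 h hh)
  have hη0 : 0 < d * h := by positivity
  generalize (d : ℝ) * h = η at *
  have hW : Integrable fun x : Ed d => (1 + ‖x‖) ^ (-((d + 1 : ℕ) : ℝ)) :=
    integrable_one_add_norm (by simp)
  have hW0 : ∀ x : Ed d, 0 ≤ (1 + ‖x‖) ^ (-((d + 1 : ℕ) : ℝ)) := fun x => by positivity
  obtain ⟨W, hWdef⟩ : ∃ W : Ed d → ℝ, ∀ x, (1 + ‖x‖) ^ (-((d + 1 : ℕ) : ℝ)) = W x :=
    ⟨_, fun _ => rfl⟩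
  simp only [hWdef] at hφC hW hW0
  have hI : 0 ≤ ∫ y, W y := integral_nonneg hW0
  refine ⟨2 * C * ∫ y, W y, by positivity, fun f hf z k => ?_⟩
  obtain ⟨x, ξ⟩ := z
  replace hfN := hfN f hf
  have hN : 0 ≤ (GSnorm s h f).toReal := ENNReal.toReal_nonneg
  generalize (GSnorm s h f).toReal = N at *
  rcases max_choice ‖x‖ ‖ξ‖ with hmax | hmax <;> simp only [hmax]
  · have hk1 := norm_pow_mul_STFTgs_le (φ := φ) (f := f) (W := fun y => C * W y) (M := N)
      (K := η ^ k * (k.factorial : ℝ) ^ s) (k := k) (hW.const_mul C)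
      (fun y => by simpa using hfN ⟨0, hd⟩ 0 0 y)
      (fun y => by simpa [mul_assoc] using hfN ⟨0, hd⟩ k 0 y)
      (fun y => by simpa using hφC ⟨0, hd⟩ 0 0 y)
      (fun y => by
        have := hφC ⟨0, hd⟩ k 0 y
        simp only [Function.iterate_zero, id, add_zero, Nat.factorial_zero, Nat.cast_one,
          mul_one] at this
        refine this.trans_eq ?_
        ring) x ξ
    rw [integral_const_mul] at hk1
    calc _ ≤ _ := hk1
      _ = (2 * C * ∫ y, W y) * N * (k.factorial : ℝ) ^ s * (2 * 1 * η) ^ k := by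
        rw [mul_pow]; ring
      _ ≤ (2 * C * ∫ y, W y) * N * (k.factorial : ℝ) ^ s * (2 * d * η) ^ k := by gcongr
      _ = _ := by ring
  · obtain ⟨j, hj⟩ := exists_norm_le_mul_abs_coord hd ξ
    have hφl : ∀ l y, ‖(pdGS j)^[l] φ y‖ ≤ (C * η ^ l * (l.factorial : ℝ) ^ s) * W y :=
      fun l y => by simpa using hφC j 0 l y
    have hk1 := abs_coord_pow_mul_STFTgs_le j (φ := φ) (f := f) (M := N) (η := η) (s := s)
      (K := C * ∫ y, W y) hs.le hη0.le hN hf.1 hφ.1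
      (fun l y => by simpa using hfN j 0 l y)
      (fun l => (hW.const_mul _).mono' (contDiff_iterate_pdGS j hφ.1 l).continuous.aestronglyMeasurable
        (Eventually.of_forall (hφl l)))
      (fun l => by
        have := integral_mono_of_nonneg (Eventually.of_forall fun y => norm_nonneg _)
          (hW.const_mul _) (Eventually.of_forall (hφl l))
        rw [integral_const_mul] at this
        exact this.trans_eq (by ring))
      x ξ k 0 0
    simp only [Function.iterate_zero, id, zero_add] at hk1
    generalize (∫ y, W y) = I at hk1 hI ⊢
    calc ‖ξ‖ ^ k * ‖STFTgs φ f (x, ξ)‖ ≤ (d * |ξ j|) ^ k * ‖STFTgs φ f (x, ξ)‖ := by gcongr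
      _ = d ^ k * (|ξ j| ^ k * ‖STFTgs φ f (x, ξ)‖) := by ring
      _ ≤ d ^ k * (N * (C * I) * 2 ^ k * η ^ k * (k.factorial : ℝ) ^ s) := by gcongr
      _ = C * I * N * (2 * d * η) ^ k * (k.factorial : ℝ) ^ s := by
        rw [mul_pow, mul_pow]; ring
      _ ≤ 2 * C * I * N * (2 * d * η) ^ k * (k.factorial : ℝ) ^ s := by
        gcongr
        linarith

theorem statement4 (d : ℕ) (hd : 1 ≤ d) (s : ℝ) (hs : 1/2 < s)
    (φ : Ed d → ℂ) (hφ : φ ∈ SigmaGS s d) (hφ0 : φ ≠ 0)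
    (A : ℝ) (hA : 0 < A) :
    ∃ h C : ℝ, 0 < h ∧ 0 < C ∧ ∀ f ∈ SigmaGS s d,
      (⨆ z : Ed d × Ed d, ENNReal.ofReal (Real.exp (A * pnorm z ^ (1/s)) * ‖STFTgs φ f z‖))
        ≤ ENNReal.ofReal C * GSnorm s h f := by
  have hs0 : 0 < s := by linarith
  have hd' : (1 : ℝ) ≤ d := by exact_mod_cast hd
  set B := A * 2 ^ (1 / s) with hB
  have hB0 : 0 < B := by positivity
  obtain ⟨h, hh, hH⟩ : ∃ h : ℝ, 0 < h ∧ 2 * d * (d * h) = (s / (2 * B)) ^ s :=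
    ⟨(s / (2 * B)) ^ s / (2 * d * d), by positivity, by field_simp⟩
  obtain ⟨C, hC, hCf⟩ := exists_pow_max_mul_STFTgs_le hd hs0 hφ hh
  refine ⟨h, 2 ^ s * C + 1, hh, by positivity, fun f hf => iSup_le fun z => ?_⟩
  have hN : 0 ≤ (GSnorm s h f).toReal := ENNReal.toReal_nonneg
  have hexp := exp_mul_le_of_pow_mul_le (s := s) (t := max ‖z.1‖ ‖z.2‖) (B := B) hs0
    (le_max_of_le_left (norm_nonneg _)) (norm_nonneg _) (by positivity) hB0.le (by positivity)
    (by
      rw [hH, ← Real.rpow_mul (by positivity), mul_one_div_cancel hs0.ne', Real.rpow_one]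
      field_simp
      rfl) (hCf f hf z)
  have hpn : A * pnorm z ^ (1 / s) ≤ B * max ‖z.1‖ ‖z.2‖ ^ (1 / s) := by
    rw [hB, mul_assoc, ← Real.mul_rpow zero_le_two (le_max_of_le_left (norm_nonneg _))]
    have := pnorm_le_two_mul_max z
    have : 0 ≤ pnorm z := Real.sqrt_nonneg _
    gcongr
  rw [← ENNReal.ofReal_toReal (hf.2 h hh).ne, ← ENNReal.ofReal_mul (by positivity)]
  refine ENNReal.ofReal_le_ofReal ?_
  calc _ ≤ Real.exp (B * max ‖z.1‖ ‖z.2‖ ^ (1 / s)) * ‖STFTgs φ f z‖ := by gcongr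
    _ ≤ 2 ^ s * (C * (GSnorm s h f).toReal) := hexp
    _ ≤ _ := by linarith

end
end

section
/- Let s > 1/2, d ≥ 1, and fix a window φ ∈ Σ_s(ℝ^d) \ {0}. For every h > 0 there exist A > 0 and C > 0 (depending on h and φ) such that for every f ∈ Σ_s(ℝ^d) one has ‖f‖_{S_{s,h}} ≤ C sup_{z ∈ ℝ^{2d}} e^{A|z|^{1/s}} |V_φ f(z)|. -/
open MeasureTheory Filter
open scoped BigOperators ENNReal RealInnerProductSpace

noncomputable section

/-- Iterated partial derivative along a list of coordinate directions, head first. -/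
def pdList {d : ℕ} : List (Fin d) → (Ed d → ℂ) → Ed d → ℂ
  | [], f => f
  | i :: L, f => pdList L (pdGS i f)

section Derivatives

variable {d : ℕ} {f g : Ed d → ℂ}

lemma pdList_append (L M : List (Fin d)) (f : Ed d → ℂ) :
    pdList (L ++ M) f = pdList M (pdList L f) := by
  induction L generalizing f with
  | nil => rfl
  | cons i L ih => exact ih _

lemma ContDiff.pdGS (hf : ContDiff ℝ ((⊤ : ℕ∞) : WithTop ℕ∞) f) (i : Fin d) :
    ContDiff ℝ ((⊤ : ℕ∞) : WithTop ℕ∞) (pdGS i f) :=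
  (hf.fderiv_right (m := ((⊤ : ℕ∞) : WithTop ℕ∞)) (by simp)).clm_apply contDiff_const

lemma ContDiff.pdList (hf : ContDiff ℝ ((⊤ : ℕ∞) : WithTop ℕ∞) f) (L : List (Fin d)) :
    ContDiff ℝ ((⊤ : ℕ∞) : WithTop ℕ∞) (pdList L f) := by
  induction L generalizing f with
  | nil => exact hf
  | cons i L ih => exact ih (hf.pdGS i)

lemma pdGS_comm (hf : ContDiff ℝ ((⊤ : ℕ∞) : WithTop ℕ∞) f) (i j : Fin d) :
    pdGS i (pdGS j f) = pdGS j (pdGS i f) := by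
  have key : ∀ i j : Fin d, ∀ x, pdGS i (pdGS j f) x =
      fderiv ℝ (fderiv ℝ f) x (EuclideanSpace.single i 1) (EuclideanSpace.single j 1) := by
    intro i j x
    have hd : DifferentiableAt ℝ (fderiv ℝ f) x :=
      ((hf.fderiv_right (m := ((⊤ : ℕ∞) : WithTop ℕ∞)) (by simp)).differentiable (by simp)) x
    change fderiv ℝ (fun y => fderiv ℝ f y (EuclideanSpace.single j 1)) x _ = _
    rw [fderiv_clm_apply hd (differentiableAt_const _)]
    simp
  funext x
  rw [key, key]
  refine (hf.contDiffAt.isSymmSndFDerivAt ?_) _ _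
  simp only [minSmoothness_of_isRCLikeNormedField]
  exact WithTop.coe_le_coe.2 (le_top (a := (2 : ℕ∞)))

lemma pdList_perm (hf : ContDiff ℝ ((⊤ : ℕ∞) : WithTop ℕ∞) f) {L M : List (Fin d)}
    (h : L.Perm M) : pdList L f = pdList M f := by
  induction h generalizing f with
  | nil => rfl
  | cons i _ ih => exact ih (hf.pdGS i)
  | swap i j L => exact congrArg (pdList L) (pdGS_comm hf i j)
  | trans _ _ ih₁ ih₂ => exact (ih₁ hf).trans (ih₂ hf)

lemma pdGS_add (hf : ContDiff ℝ ((⊤ : ℕ∞) : WithTop ℕ∞) f)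
    (hg : ContDiff ℝ ((⊤ : ℕ∞) : WithTop ℕ∞) g) (i : Fin d) :
    pdGS i (fun x => f x + g x) = fun x => pdGS i f x + pdGS i g x := by
  funext x
  unfold _root_.pdGS
  rw [fderiv_fun_add (hf.differentiable (by simp) x) (hg.differentiable (by simp) x)]
  rfl

lemma pdList_add (hf : ContDiff ℝ ((⊤ : ℕ∞) : WithTop ℕ∞) f)
    (hg : ContDiff ℝ ((⊤ : ℕ∞) : WithTop ℕ∞) g) (L : List (Fin d)) :
    pdList L (fun x => f x + g x) = fun x => pdList L f x + pdList L g x := by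
  induction L generalizing f g with
  | nil => rfl
  | cons i L ih =>
    simp only [pdList]
    rw [pdGS_add hf hg, ih (hf.pdGS i) (hg.pdGS i)]

lemma pdGS_mul (hf : ContDiff ℝ ((⊤ : ℕ∞) : WithTop ℕ∞) f)
    (hg : ContDiff ℝ ((⊤ : ℕ∞) : WithTop ℕ∞) g) (i : Fin d) :
    pdGS i (fun x => f x * g x) = fun x => pdGS i f x * g x + f x * pdGS i g x := by
  funext x
  unfold _root_.pdGS
  rw [fderiv_fun_mul (hf.differentiable (by simp) x) (hg.differentiable (by simp) x)]
  simp only [add_apply, smul_apply, smul_eq_mul]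
  ring

/-- One step of the Leibniz rule. -/
lemma pdList_cons_mul (hf : ContDiff ℝ ((⊤ : ℕ∞) : WithTop ℕ∞) f)
    (hg : ContDiff ℝ ((⊤ : ℕ∞) : WithTop ℕ∞) g) (i : Fin d) (L : List (Fin d)) :
    pdList (i :: L) (fun x => f x * g x) =
      fun x => pdList L (fun x => pdGS i f x * g x) x +
        pdList L (fun x => f x * pdGS i g x) x := by
  simp only [pdList]
  rw [pdGS_mul hf hg, pdList_add ((hf.pdGS i).mul hg) (hf.mul (hg.pdGS i))]

lemma pdList_conj (hf : ContDiff ℝ ((⊤ : ℕ∞) : WithTop ℕ∞) f) (L : List (Fin d)) :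
    pdList L (fun x => (starRingEnd ℂ) (f x)) = fun x => (starRingEnd ℂ) (pdList L f x) := by
  induction L generalizing f with
  | nil => rfl
  | cons i L ih =>
    simp only [pdList]
    rw [← ih (hf.pdGS i)]
    congr 1
    funext x
    have := ((Complex.conjCLE : ℂ →L[ℝ] ℂ).hasFDerivAt.comp x
      (hf.differentiable (by simp) x).hasFDerivAt).fderiv
    change fderiv ℝ ((Complex.conjCLE : ℂ →L[ℝ] ℂ) ∘ f) x _ = _
    rw [this]
    rfl

lemma pdList_comp_sub (f : Ed d → ℂ) (x : Ed d) (L : List (Fin d)) :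
    pdList L (fun y => f (y - x)) = fun y => pdList L f (y - x) := by
  induction L generalizing f with
  | nil => rfl
  | cons i L ih =>
    simp only [pdList]
    rw [← ih]
    congr 1
    funext y
    unfold pdGS
    rw [fderiv_comp_sub]

/-- A common bound for all terms of the Leibniz expansion gives a bound for the derivative of
the product. -/
lemma norm_pdList_mul_le (hf : ContDiff ℝ ((⊤ : ℕ∞) : WithTop ℕ∞) f)
    (hg : ContDiff ℝ ((⊤ : ℕ∞) : WithTop ℕ∞) g) (L : List (Fin d)) (y : Ed d) {B c : ℝ}
    (hc : 0 ≤ c)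
    (hB : ∀ L₁ L₂ : List (Fin d), (L₁ ++ L₂).Perm L →
      c * (‖pdList L₁ f y‖ * ‖pdList L₂ g y‖) ≤ B) :
    c * ‖pdList L (fun x => f x * g x) y‖ ≤ 2 ^ L.length * B := by
  induction L generalizing f g with
  | nil => simpa [pdList] using hB [] [] (List.Perm.refl _)
  | cons i L ih =>
    rw [pdList_cons_mul hf hg]
    have h₁ := ih (hf.pdGS i) hg fun L₁ L₂ h => hB (i :: L₁) L₂ (h.cons i)
    have h₂ := ih hf (hg.pdGS i) fun L₁ L₂ h =>
      hB L₁ (i :: L₂) (List.perm_middle.trans (h.cons i))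
    calc _ ≤ c * (‖pdList L (fun x => pdGS i f x * g x) y‖ +
          ‖pdList L (fun x => f x * pdGS i g x) y‖) := by gcongr; exact norm_add_le _ _
      _ ≤ 2 ^ L.length * B + 2 ^ L.length * B := by rw [mul_add]; exact add_le_add h₁ h₂
      _ = _ := by simp only [List.length_cons, pow_succ]; ring

lemma pdList_replicate (i : Fin d) (n : ℕ) (f : Ed d → ℂ) :
    pdList (List.replicate n i) f = (pdGS i)^[n] f := by
  induction n generalizing f with
  | zero => rfl
  | succ n ih => exact ih _

lemma exists_list_mderiv (β : Fin d → ℕ) :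
    ∃ L : List (Fin d), (∀ i, L.count i = β i) ∧ ∀ f : Ed d → ℂ, mderiv β f = pdList L f := by
  have key : ∀ l : List (Fin d), ∃ L : List (Fin d),
      (∀ i, L.count i = (l.map fun j => if j = i then β i else 0).sum) ∧
      ∀ f : Ed d → ℂ, ((l.map fun i => (pdGS i)^[β i]).foldr (· ∘ ·) id) f = pdList L f := by
    intro l
    induction l with
    | nil => exact ⟨[], by simp, fun _ => rfl⟩
    | cons j l ih =>
      obtain ⟨L, hL, hLf⟩ := ih
      refine ⟨L ++ List.replicate (β j) j, fun i => ?_, fun f => ?_⟩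
      · rw [List.count_append, hL, List.map_cons, List.sum_cons, List.count_replicate, add_comm]
        by_cases h : j = i
        · subst h; simp
        · simp [h]
      · rw [pdList_append, ← hLf, pdList_replicate]
        rfl
  obtain ⟨L, hL, hLf⟩ := key (List.finRange d)
  refine ⟨L, fun i => ?_, fun f => ?_⟩
  · rw [hL, ← List.ofFn_eq_map, List.sum_ofFn]
    simp
  · rw [← hLf, ← List.ofFn_eq_map]
    rfl

lemma pdList_eq_mderiv (hf : ContDiff ℝ ((⊤ : ℕ∞) : WithTop ℕ∞) f) (L : List (Fin d)) :
    pdList L f = mderiv (fun i => L.count i) f := by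
  obtain ⟨M, hM, hMf⟩ := exists_list_mderiv (fun i => L.count i)
  rw [hMf]
  exact pdList_perm hf (List.perm_iff_count.2 fun i => (hM i).symm)

end Derivatives

/-- Smooth functions all of whose partial derivatives are bounded and integrable. -/
structure HasL1Derivs {d : ℕ} (f : Ed d → ℂ) : Prop where
  smooth : ContDiff ℝ ((⊤ : ℕ∞) : WithTop ℕ∞) f
  integrable_pdList : ∀ L : List (Fin d), Integrable (pdList L f)
  bounded_pdList : ∀ L : List (Fin d), ∃ C, ∀ x, ‖pdList L f x‖ ≤ C

section Coordinates

variable {d : ℕ}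

lemma sum_coord_smul_single (v : Ed d) :
    ∑ i, v i • (EuclideanSpace.single i (1 : ℝ) : Ed d) = v := by
  simpa using (EuclideanSpace.basisFun (Fin d) ℝ).sum_repr v

lemma norm_le_sum_abs (v : Ed d) : ‖v‖ ≤ ∑ i, |v i| := by
  calc ‖v‖ = ‖∑ i, v i • (EuclideanSpace.single i (1 : ℝ) : Ed d)‖ := by
        rw [sum_coord_smul_single]
    _ ≤ ∑ i, ‖v i • (EuclideanSpace.single i (1 : ℝ) : Ed d)‖ := norm_sum_le _ _
    _ = _ := by simp [norm_smul]

lemma abs_coord_le_norm (v : Ed d) (i : Fin d) : |v i| ≤ ‖v‖ := PiLp.norm_apply_le v i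

lemma one_add_norm_pow_le (v : Ed d) (n : ℕ) :
    (1 + ‖v‖) ^ n ≤ ((d : ℝ) + 1) ^ n * (1 + ∑ i, |v i| ^ n) := by
  have key : ∀ m : ℝ, 1 ≤ m → (∀ i, |v i| ≤ m) → 1 + ‖v‖ ≤ (d + 1) * m := by
    intro m hm h
    have : ∑ i, |v i| ≤ d * m := by
      simpa using Finset.sum_le_sum fun i (_ : i ∈ Finset.univ) => h i
    linarith [norm_le_sum_abs v]
  have hs : 0 ≤ ∑ i, |v i| ^ n := Finset.sum_nonneg fun i _ => by positivity
  by_cases h : ∀ i, |v i| ≤ 1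
  · calc (1 + ‖v‖) ^ n ≤ ((d + 1) * 1) ^ n := by
          gcongr
          exact key 1 le_rfl h
      _ = ((d : ℝ) + 1) ^ n * 1 := by ring
      _ ≤ _ := by gcongr; linarith
  · push Not at h
    obtain ⟨j, hj⟩ := h
    obtain ⟨i, -, hi⟩ := Finset.exists_max_image Finset.univ (fun i => |v i|) ⟨j, Finset.mem_univ j⟩
    calc (1 + ‖v‖) ^ n ≤ ((d + 1) * |v i|) ^ n := by
          gcongr
          exact key _ (hj.le.trans (hi j (Finset.mem_univ j))) fun k => hi k (Finset.mem_univ k)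
      _ = ((d : ℝ) + 1) ^ n * |v i| ^ n := mul_pow _ _ _
      _ ≤ _ := by
          gcongr
          have := Finset.single_le_sum (f := fun i => |v i| ^ n) (fun i _ => by positivity)
            (Finset.mem_univ i)
          simp only at this
          linarith

lemma norm_fderiv_le_sum_pdGS (f : Ed d → ℂ) (x : Ed d) :
    ‖fderiv ℝ f x‖ ≤ ∑ i, ‖pdGS i f x‖ := by
  refine ContinuousLinearMap.opNorm_le_bound _ (Finset.sum_nonneg fun i _ => norm_nonneg _) ?_
  intro v
  calc ‖fderiv ℝ f x v‖ = ‖∑ i, v i • pdGS i f x‖ := by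
        conv_lhs => rw [← sum_coord_smul_single v]
        simp only [map_sum, map_smul]
        rfl
    _ ≤ ∑ i, ‖v i • pdGS i f x‖ := norm_sum_le _ _
    _ ≤ ∑ i, ‖pdGS i f x‖ * ‖v‖ := by
        gcongr with i
        rw [norm_smul, mul_comm, Real.norm_eq_abs]
        gcongr
        exact abs_coord_le_norm v i
    _ = _ := (Finset.sum_mul _ _ _).symm

end Coordinates

section HasL1Derivs

open scoped FourierTransform

variable {d : ℕ} {f g : Ed d → ℂ}

lemma HasL1Derivs.pdGS (hf : HasL1Derivs f) (i : Fin d) : HasL1Derivs (pdGS i f) :=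
  ⟨hf.smooth.pdGS i, fun L => hf.integrable_pdList (i :: L),
    fun L => hf.bounded_pdList (i :: L)⟩

lemma HasL1Derivs.integrable (hf : HasL1Derivs f) : Integrable f := hf.integrable_pdList []

lemma HasL1Derivs.conj (hf : HasL1Derivs f) :
    HasL1Derivs fun x => (starRingEnd ℂ) (f x) := by
  refine ⟨(Complex.conjCLE : ℂ →L[ℝ] ℂ).contDiff.comp hf.smooth, fun L => ?_, fun L => ?_⟩
  · rw [pdList_conj hf.smooth]
    exact (Complex.conjCLE : ℂ →L[ℝ] ℂ).integrable_comp (hf.integrable_pdList L)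
  · rw [pdList_conj hf.smooth]
    simpa using hf.bounded_pdList L

lemma HasL1Derivs.comp_sub (hf : HasL1Derivs f) (x : Ed d) :
    HasL1Derivs fun y => f (y - x) := by
  refine ⟨hf.smooth.comp (contDiff_id.sub contDiff_const), fun L => ?_, fun L => ?_⟩
  · rw [pdList_comp_sub]
    exact (hf.integrable_pdList L).comp_sub_right x
  · rw [pdList_comp_sub]
    obtain ⟨C, hC⟩ := hf.bounded_pdList L
    exact ⟨C, fun y => hC _⟩

lemma HasL1Derivs.mul (hf : HasL1Derivs f) (hg : HasL1Derivs g) :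
    HasL1Derivs fun x => f x * g x := by
  have key : ∀ (L : List (Fin d)) {f g : Ed d → ℂ}, HasL1Derivs f → HasL1Derivs g →
      Integrable (pdList L fun x => f x * g x) ∧
        ∃ C, ∀ x, ‖pdList L (fun x => f x * g x) x‖ ≤ C := by
    intro L
    induction L with
    | nil =>
      intro f g hf hg
      obtain ⟨C, hC⟩ := hf.bounded_pdList []
      obtain ⟨D, hD⟩ := hg.bounded_pdList []
      refine ⟨hg.integrable.bdd_mul hf.smooth.continuous.aestronglyMeasurable
        (Eventually.of_forall hC), C * D, fun x => ?_⟩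
      change ‖f x * g x‖ ≤ _
      rw [norm_mul]
      exact mul_le_mul (hC x) (hD x) (norm_nonneg _) ((norm_nonneg _).trans (hC x))
    | cons i L ih =>
      intro f g hf hg
      rw [pdList_cons_mul hf.smooth hg.smooth]
      obtain ⟨h₁, C₁, hC₁⟩ := ih (hf.pdGS i) hg
      obtain ⟨h₂, C₂, hC₂⟩ := ih hf (hg.pdGS i)
      exact ⟨h₁.add h₂, C₁ + C₂, fun x => (norm_add_le _ _).trans (add_le_add (hC₁ x) (hC₂ x))⟩
  exact ⟨hf.smooth.mul hg.smooth, fun L => (key L hf hg).1, fun L => (key L hf hg).2⟩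

lemma HasL1Derivs.fourier_pdGS (hf : HasL1Derivs f) (i : Fin d) (w : Ed d) :
    𝓕 (_root_.pdGS i f) w = 2 * Real.pi * Complex.I * w i * 𝓕 f w := by
  have hd : Integrable (fderiv ℝ f) := by
    refine Integrable.mono' (integrable_finsetSum Finset.univ
      fun i _ => (hf.integrable_pdList [i]).norm) ?_
      (Eventually.of_forall (norm_fderiv_le_sum_pdGS f))
    exact (hf.smooth.continuous_fderiv (by simp)).aestronglyMeasurable
  have h := congrFun (Real.fourier_fderiv hf.integrable (hf.smooth.differentiable (by simp)) hd) w
  have h' := congrArg (fun T : Ed d →L[ℝ] ℂ => T (EuclideanSpace.single i 1)) h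
  simp only [VectorFourier.fourierSMulRight_apply] at h'
  rw [Real.fourier_continuousLinearMap_apply hd] at h'
  change 𝓕 (_root_.pdGS i f) w = _ at h'
  rw [h']
  simp [innerSL_apply_apply ℝ, EuclideanSpace.inner_single_right]
  ring

lemma HasL1Derivs.fourier_pdList (hf : HasL1Derivs f) (L : List (Fin d)) (w : Ed d) :
    𝓕 (pdList L f) w = (L.map fun i => 2 * Real.pi * Complex.I * w i).prod * 𝓕 f w := by
  induction L generalizing f with
  | nil => simp [pdList]
  | cons i L ih =>
    simp only [pdList, List.map_cons, List.prod_cons]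
    rw [ih (hf.pdGS i), hf.fourier_pdGS]
    ring

lemma HasL1Derivs.integral_pdGS (hf : HasL1Derivs f) (i : Fin d) :
    ∫ x, _root_.pdGS i f x = 0 := by
  simpa [Real.fourier_eq] using hf.fourier_pdGS i 0

lemma norm_prod_map_eq (L : List (Fin d)) (w : Ed d) :
    ‖(L.map fun i => 2 * Real.pi * Complex.I * w i).prod‖ =
      |mpow ((2 * Real.pi) • w) fun i => L.count i| := by
  have h := Finset.prod_list_map_count L fun i => 2 * Real.pi * Complex.I * w i
  rw [h, norm_prod, mpow, Finset.abs_prod]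
  refine Finset.prod_subset_one_on_sdiff (Finset.subset_univ _) ?_ ?_
  · intro i hi
    simp only [Finset.mem_sdiff, Finset.mem_univ, List.mem_toFinset, true_and] at hi
    simp [List.count_eq_zero.2 hi]
  · intro i _
    simp [abs_mul, abs_of_pos Real.pi_pos]

/-- Fourier inversion turns a weighted `L¹` bound of the transform into a bound of derivatives. -/
lemma HasL1Derivs.norm_pdList_le (hf : HasL1Derivs f) (L : List (Fin d)) {G : Ed d → ℝ}
    (hG : Integrable G)
    (h : ∀ w, |mpow ((2 * Real.pi) • w) fun i => L.count i| * ‖𝓕 f w‖ ≤ G w) (y : Ed d) :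
    ‖pdList L f y‖ ≤ ∫ w, G w := by
  have hb : ∀ w, ‖𝓕 (pdList L f) w‖ ≤ G w := fun w => by
    rw [hf.fourier_pdList, norm_mul, norm_prod_map_eq]
    exact h w
  have hc : Continuous (𝓕 (pdList L f)) :=
    VectorFourier.fourierIntegral_continuous Real.continuous_fourierChar
      (by exact continuous_inner) (hf.integrable_pdList L)
  have hi : Integrable (𝓕 (pdList L f)) :=
    hG.mono' hc.aestronglyMeasurable (Eventually.of_forall hb)
  rw [← (hf.smooth.pdList L).continuous.fourierInv_fourier_eq (hf.integrable_pdList L) hi,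
    Real.fourierInv_eq]
  refine norm_integral_le_of_norm_le hG (Eventually.of_forall fun w => ?_)
  rw [Circle.norm_smul]
  exact hb w

/-- Integrating the translates of `ψ` out of the derivatives of `f · ψ(· - x)`. -/
lemma HasL1Derivs.integral_pdList_mul_comp_sub (hf : HasL1Derivs f) (hg : HasL1Derivs g)
    (L : List (Fin d)) (y : Ed d) :
    Integrable (fun x => pdList L (fun y => f y * g (y - x)) y) ∧
      ∫ x, pdList L (fun y => f y * g (y - x)) y = pdList L f y * ∫ u, g u := by
  induction L generalizing f g with
  | nil =>
    refine ⟨(hg.integrable.comp_sub_left y).const_mul (f y), ?_⟩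
    simp only [pdList]
    rw [integral_const_mul, integral_sub_left_eq_self g volume y]
  | cons i L ih =>
    have hs : ∀ x, pdList (i :: L) (fun y => f y * g (y - x)) y =
        pdList L (fun y => _root_.pdGS i f y * g (y - x)) y +
          pdList L (fun y => f y * _root_.pdGS i g (y - x)) y := by
      intro x
      rw [pdList_cons_mul hf.smooth (hg.comp_sub x).smooth,
        show _root_.pdGS i (fun y => g (y - x)) = fun y => _root_.pdGS i g (y - x) from
          pdList_comp_sub g x [i]]
    obtain ⟨h₁, e₁⟩ := ih (hf.pdGS i) hg
    obtain ⟨h₂, e₂⟩ := ih hf (hg.pdGS i)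
    simp only [hs]
    refine ⟨h₁.add h₂, ?_⟩
    rw [integral_add h₁ h₂, e₁, e₂, hg.integral_pdGS, mul_zero, add_zero]
    rfl

end HasL1Derivs

section Moments

variable {d : ℕ}

lemma integrable_of_bounded_moments {E : Type*} [NormedAddCommGroup E] {g : Ed d → E}
    (hg : AEStronglyMeasurable g)
    (h : ∀ α : Fin d → ℕ, ∃ C, ∀ x, |mpow x α| * ‖g x‖ ≤ C) : Integrable g := by
  choose C hC using h
  have h0 : ∀ x, ‖g x‖ ≤ C 0 := fun x => by simpa [mpow] using hC 0 x
  have hi : ∀ i x, |x i| ^ (d + 1) * ‖g x‖ ≤ C (Pi.single i (d + 1)) := fun i x => by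
    have := hC (Pi.single i (d + 1)) x
    have e : mpow x (Pi.single i (d + 1)) = x i ^ (d + 1) := by
      rw [mpow, Finset.prod_eq_single i]
      · simp
      · intro j _ hj; simp [hj]
      · simp
    rwa [e, abs_pow] at this
  have hI : Integrable fun x : Ed d => (1 + ‖x‖) ^ (-((d : ℝ) + 1)) :=
    integrable_one_add_norm (by simp)
  refine Integrable.mono' (hI.const_mul
    (((d : ℝ) + 1) ^ (d + 1) * (C 0 + ∑ i, C (Pi.single i (d + 1))))) hg
    (Eventually.of_forall fun x => ?_)
  have hp : 0 < 1 + ‖x‖ := by positivity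
  rw [Real.rpow_neg hp.le, ← div_eq_mul_inv,
    show (d : ℝ) + 1 = ((d + 1 : ℕ) : ℝ) by push_cast; ring, Real.rpow_natCast,
    le_div_iff₀ (by positivity), mul_comm]
  calc (1 + ‖x‖) ^ (d + 1) * ‖g x‖
      ≤ (((d : ℝ) + 1) ^ (d + 1) * (1 + ∑ i, |x i| ^ (d + 1))) * ‖g x‖ := by
        gcongr
        exact one_add_norm_pow_le x _
    _ = ((d : ℝ) + 1) ^ (d + 1) * (‖g x‖ + ∑ i, |x i| ^ (d + 1) * ‖g x‖) := by
        rw [← Finset.sum_mul]; ring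
    _ ≤ ((d : ℝ) + 1) ^ (d + 1) * (C 0 + ∑ i, C (Pi.single i (d + 1))) := by
        gcongr with i
        · exact h0 x
        · exact hi i x
    _ = _ := by push_cast; ring

lemma pow_le_factorial_rpow_mul_exp {s b t : ℝ} (hs : 0 < s) (hb : 0 < b) (ht : 0 ≤ t) (k : ℕ) :
    t ^ k ≤ (b ^ (-s)) ^ k * (k.factorial : ℝ) ^ s * Real.exp (s * b * t ^ (1 / s)) := by
  have hu : 0 ≤ b * t ^ (1 / s) := by positivity
  have h := Real.pow_div_factorial_le_exp _ hu k
  rw [div_le_iff₀ (by positivity)] at h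
  have h2 := Real.rpow_le_rpow (by positivity) h hs.le
  rw [Real.mul_rpow (Real.exp_pos _).le (by positivity), ← Real.exp_mul,
    ← Real.rpow_natCast, ← Real.rpow_mul hu, mul_comm (k : ℝ), Real.rpow_mul hu,
    Real.rpow_natCast, Real.mul_rpow hb.le (by positivity), ← Real.rpow_mul ht,
    one_div_mul_cancel hs.ne', Real.rpow_one] at h2
  have hbs : 0 < b ^ s := by positivity
  calc t ^ k = (b ^ (-s)) ^ k * (b ^ s * t) ^ k := by
        rw [← mul_pow, Real.rpow_neg hb.le, inv_mul_cancel_left₀ hbs.ne']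
    _ ≤ (b ^ (-s)) ^ k * (Real.exp (b * t ^ (1 / s) * s) * (k.factorial : ℝ) ^ s) := by gcongr
    _ = _ := by
        rw [show s * b * t ^ (1 / s) = b * t ^ (1 / s) * s by ring]
        ring

lemma abs_mpow_le_s5 {s b : ℝ} (hs : 0 < s) (hb : 0 < b) (v : Ed d) (γ : Fin d → ℕ) :
    |mpow v γ| ≤ (b ^ (-s)) ^ mlen γ * (mfact γ : ℝ) ^ s *
      Real.exp (s * b * d * ‖v‖ ^ (1 / s)) := by
  calc |mpow v γ| = ∏ i, |v i| ^ γ i := by simp [mpow, Finset.abs_prod]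
    _ ≤ ∏ i, ((b ^ (-s)) ^ γ i * ((γ i).factorial : ℝ) ^ s *
          Real.exp (s * b * ‖v‖ ^ (1 / s))) := by
        refine Finset.prod_le_prod (fun i _ => by positivity) fun i _ => ?_
        refine (pow_le_factorial_rpow_mul_exp hs hb (abs_nonneg (v i)) (γ i)).trans ?_
        gcongr
        exact abs_coord_le_norm v i
    _ = _ := by
        rw [Finset.prod_mul_distrib, Finset.prod_mul_distrib, Finset.prod_pow_eq_pow_sum, mlen,
          mfact, Nat.cast_prod, Real.finsetProd_rpow _ _ fun i _ => by positivity,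
          Finset.prod_const, Finset.card_univ, Fintype.card_fin, ← Real.exp_nat_mul]
        congr 2
        ring

lemma integrable_exp_neg_norm_rpow {s : ℝ} (hs : 0 < s) :
    Integrable fun x : Ed d => Real.exp (-‖x‖ ^ (1 / s)) := by
  have hc : Continuous fun x : Ed d => Real.exp (-‖x‖ ^ (1 / s)) :=
    Real.continuous_exp.comp ((continuous_norm.rpow_const fun _ => Or.inr (by positivity)).neg)
  refine integrable_of_bounded_moments hc.aestronglyMeasurable fun α => ?_
  have hb : 0 < 1 / (s * (d + 1)) := by positivity
  refine ⟨((1 / (s * ((d : ℝ) + 1))) ^ (-s)) ^ mlen α * (mfact α : ℝ) ^ s, fun x => ?_⟩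
  rw [Real.norm_of_nonneg (Real.exp_pos _).le, Real.exp_neg, ← div_eq_mul_inv,
    div_le_iff₀ (Real.exp_pos _)]
  refine (abs_mpow_le_s5 hs hb x α).trans ?_
  gcongr
  have : s * (1 / (s * ((d : ℝ) + 1))) * d ≤ 1 := by
    rw [show s * (1 / (s * ((d : ℝ) + 1))) * d = d / (d + 1) by field_simp]
    rw [div_le_one (by positivity)]
    linarith
  exact mul_le_of_le_one_left (by positivity) this

lemma exists_abs_mpow_le_mul (x y : Ed d) (α : Fin d → ℕ) :
    ∃ α₁ α₂ : Fin d → ℕ,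
      |mpow y α| ≤ 2 ^ mlen α * (|mpow x α₁| * |mpow (y - x) α₂|) ∧
      mlen α₁ + mlen α₂ = mlen α ∧ mfact α₁ * mfact α₂ = mfact α := by
  classical
  refine ⟨fun i => if |y i - x i| ≤ |x i| then α i else 0,
    fun i => if |y i - x i| ≤ |x i| then 0 else α i, ?_, ?_, ?_⟩
  · simp only [mpow, Finset.abs_prod, mlen]
    rw [← Finset.prod_pow_eq_pow_sum, ← Finset.prod_mul_distrib, ← Finset.prod_mul_distrib]
    refine Finset.prod_le_prod (fun i _ => abs_nonneg _) fun i _ => ?_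
    have ht : |y i| ≤ |x i| + |y i - x i| := by
      simpa using abs_add_le (x i) (y i - x i)
    rw [abs_pow]
    split_ifs with hi
    · rw [pow_zero, abs_one, mul_one, abs_pow, ← mul_pow]
      gcongr
      linarith
    · rw [pow_zero, abs_one, one_mul, abs_pow, ← mul_pow]
      simp only [PiLp.sub_apply]
      gcongr
      linarith
  · rw [mlen, mlen, mlen, ← Finset.sum_add_distrib]
    refine Finset.sum_congr rfl fun i _ => ?_
    split_ifs <;> simp
  · rw [mfact, mfact, mfact, ← Finset.prod_mul_distrib]
    refine Finset.prod_congr rfl fun i _ => ?_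
    split_ifs <;> simp

lemma mlen_count (L : List (Fin d)) : (mlen fun i => L.count i) = L.length := by
  induction L with
  | nil => simp [mlen]
  | cons j L ih =>
    simp only [mlen, List.count_cons, Finset.sum_add_distrib] at ih ⊢
    simp [ih]

lemma mfact_mul_le (γ δ : Fin d → ℕ) : mfact γ * mfact δ ≤ mfact (γ + δ) := by
  rw [mfact, mfact, mfact, ← Finset.prod_mul_distrib]
  exact Finset.prod_le_prod' fun i _ =>
    Nat.le_of_dvd (Nat.factorial_pos _) (Nat.factorial_mul_factorial_dvd_factorial_add _ _)

lemma mfact_pos (γ : Fin d → ℕ) : 0 < mfact γ :=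
  Finset.prod_pos fun _ _ => Nat.factorial_pos _

end Moments

section GelfandShilov

open scoped FourierTransform

variable {d : ℕ} {s h : ℝ} {f φ : Ed d → ℂ}

lemma GSnorm.exists_bound (hh : 0 < h) (hf : GSnorm s h f < ⊤) :
    ∃ C, 0 ≤ C ∧ ∀ x α β, |mpow x α| * ‖mderiv β f x‖ ≤
      C * (h ^ (mlen α + mlen β) * ((mfact α : ℝ) * (mfact β : ℝ)) ^ s) := by
  refine ⟨(GSnorm s h f).toReal, ENNReal.toReal_nonneg, fun x α β => ?_⟩
  have hα := mfact_pos α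
  have hβ := mfact_pos β
  rw [← div_le_iff₀ (by positivity), ← ENNReal.ofReal_le_iff_le_toReal hf.ne]
  exact le_iSup_of_le x (le_iSup_of_le α (le_iSup_of_le β le_rfl))

lemma SigmaGS.hasL1Derivs (hf : f ∈ SigmaGS s d) : HasL1Derivs f := by
  obtain ⟨C, -, hC⟩ := GSnorm.exists_bound one_pos (hf.2 1 one_pos)
  refine ⟨hf.1, fun L => ?_, fun L => ?_⟩
  · refine integrable_of_bounded_moments (hf.1.pdList L).continuous.aestronglyMeasurable
      fun α => ?_
    rw [pdList_eq_mderiv hf.1]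
    exact ⟨_, fun x => hC x α _⟩
  · rw [pdList_eq_mderiv hf.1]
    exact ⟨_, fun x => by simpa [mpow] using hC x 0 fun i => L.count i⟩

lemma fourier_mul_conj_window (φ f : Ed d → ℂ) (x w : Ed d) :
    𝓕 (fun y => f y * (starRingEnd ℂ) (φ (y - x))) w =
      STFTgs φ f (x, (2 * Real.pi) • w) := by
  rw [Real.fourier_eq', STFTgs]
  refine integral_congr_ae (Eventually.of_forall fun y => ?_)
  simp only [inner_smul_right, smul_eq_mul]
  rw [mul_comm]
  congr 2
  push_cast
  ring

lemma exp_mul_pnorm_le {κ p : ℝ} (hκ : 0 ≤ κ) (hp : 0 ≤ p) (x ξ : Ed d) :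
    Real.exp (κ * ‖x‖ ^ p) * Real.exp (κ * ‖ξ‖ ^ p) ≤ Real.exp (2 * κ * pnorm (x, ξ) ^ p) := by
  rw [← Real.exp_add]
  gcongr
  have h₁ : ‖x‖ ^ p ≤ pnorm (x, ξ) ^ p :=
    Real.rpow_le_rpow (norm_nonneg _) (Real.le_sqrt_of_sq_le (by simp)) hp
  have h₂ : ‖ξ‖ ^ p ≤ pnorm (x, ξ) ^ p :=
    Real.rpow_le_rpow (norm_nonneg _) (Real.le_sqrt_of_sq_le (by simp)) hp
  nlinarith

lemma integral_conj_mul_self_ne_zero (hφ : HasL1Derivs φ) (hφ0 : φ ≠ 0) :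
    ∫ u, (starRingEnd ℂ) (φ u) * φ u ≠ 0 := by
  have e : ∀ u, (starRingEnd ℂ) (φ u) * φ u = ((‖φ u‖ ^ 2 : ℝ) : ℂ) := fun u => by
    rw [Complex.conj_mul']
    push_cast
    rfl
  have hi : Integrable fun u => ‖φ u‖ ^ 2 := by
    simpa [e] using (hφ.conj.mul hφ).integrable.norm
  simp only [e]
  rw [integral_complex_ofReal, Complex.ofReal_ne_zero]
  obtain ⟨u, hu⟩ := Function.ne_iff.1 hφ0
  refine (integral_pos_of_integrable_nonneg_nonzero (x := u)
    (hφ.smooth.continuous.norm.pow 2) hi (fun u => sq_nonneg ‖φ u‖) ?_).ne'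
  simpa using hu

end GelfandShilov

section Estimate

open scoped FourierTransform

variable {d : ℕ} {s h : ℝ} {f φ : Ed d → ℂ}

/-- The derivatives of `f · conj φ(· - x)` are controlled by the decay of `V_φ f(x, ·)`. -/
lemma norm_pdList_mul_window_le {κ ρ N : ℝ} (hs : 0 < s) (hκ : 0 ≤ κ) (hρ : 0 ≤ ρ)
    (hE : ∀ (v : Ed d) (γ : Fin d → ℕ),
      |mpow v γ| ≤ ρ ^ mlen γ * (mfact γ : ℝ) ^ s * Real.exp (κ * ‖v‖ ^ (1 / s)))
    (hf : HasL1Derivs f) (hφ : HasL1Derivs φ)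
    (hV : ∀ z, Real.exp (2 * (κ + 1) * pnorm z ^ (1 / s)) * ‖STFTgs φ f z‖ ≤ N)
    (L : List (Fin d)) (x y : Ed d) :
    ‖pdList L (fun y => f y * (starRingEnd ℂ) (φ (y - x))) y‖ ≤
      N * Real.exp (-(κ + 1) * ‖x‖ ^ (1 / s)) *
        (ρ ^ L.length * (mfact (fun i => L.count i) : ℝ) ^ s) *
        ∫ w : Ed d, Real.exp (-‖(2 * Real.pi) • w‖ ^ (1 / s)) := by
  rw [← integral_const_mul]
  refine (hf.mul (hφ.conj.comp_sub x)).norm_pdList_le L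
    (((integrable_exp_neg_norm_rpow hs).comp_smul (by positivity)).const_mul _) (fun w => ?_) y
  rw [fourier_mul_conj_window]
  set ξ : Ed d := (2 * Real.pi) • w
  have hp : 0 ≤ 1 / s := by positivity
  have h₁ : Real.exp ((κ + 1) * ‖x‖ ^ (1 / s)) * Real.exp ((κ + 1) * ‖ξ‖ ^ (1 / s)) *
      ‖STFTgs φ f (x, ξ)‖ ≤ N :=
    (mul_le_mul_of_nonneg_right (exp_mul_pnorm_le (by positivity) hp x ξ) (norm_nonneg _)).trans
      (hV _)
  have h₂ := hE ξ fun i => L.count i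
  rw [mlen_count] at h₂
  have e₁ : Real.exp (-(κ + 1) * ‖x‖ ^ (1 / s)) = (Real.exp ((κ + 1) * ‖x‖ ^ (1 / s)))⁻¹ := by
    rw [neg_mul, Real.exp_neg]
  have e₂ : Real.exp (-‖ξ‖ ^ (1 / s)) =
      Real.exp (κ * ‖ξ‖ ^ (1 / s)) * (Real.exp ((κ + 1) * ‖ξ‖ ^ (1 / s)))⁻¹ := by
    rw [← Real.exp_neg, ← Real.exp_add]
    congr 1
    ring
  have h₃ : ‖STFTgs φ f (x, ξ)‖ ≤ N * (Real.exp ((κ + 1) * ‖x‖ ^ (1 / s)))⁻¹ *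
      (Real.exp ((κ + 1) * ‖ξ‖ ^ (1 / s)))⁻¹ := by
    rw [mul_assoc, ← mul_inv, ← div_eq_mul_inv, le_div_iff₀ (by positivity), mul_comm]
    exact h₁
  calc _ ≤ ρ ^ L.length * (mfact fun i => L.count i : ℝ) ^ s * Real.exp (κ * ‖ξ‖ ^ (1 / s)) *
        (N * (Real.exp ((κ + 1) * ‖x‖ ^ (1 / s)))⁻¹ *
          (Real.exp ((κ + 1) * ‖ξ‖ ^ (1 / s)))⁻¹) := by gcongr
    _ = _ := by rw [e₁, e₂]; ring

/-- Bound for the terms of the Leibniz expansion of `(f · conj φ(· - x)) · φ(· - x)`. -/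
lemma mpow_mul_norm_pdList_mul_le {κ ρ N C : ℝ} (hs : 0 < s) (hκ : 0 ≤ κ) (hρ : 0 ≤ ρ)
    (hN : 0 ≤ N) (hC : 0 ≤ C)
    (hE : ∀ (v : Ed d) (γ : Fin d → ℕ),
      |mpow v γ| ≤ ρ ^ mlen γ * (mfact γ : ℝ) ^ s * Real.exp (κ * ‖v‖ ^ (1 / s)))
    (hf : HasL1Derivs f) (hφ : HasL1Derivs φ)
    (hφC : ∀ x α β, |mpow x α| * ‖mderiv β φ x‖ ≤
      C * (ρ ^ (mlen α + mlen β) * ((mfact α : ℝ) * (mfact β : ℝ)) ^ s))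
    (hV : ∀ z, Real.exp (2 * (κ + 1) * pnorm z ^ (1 / s)) * ‖STFTgs φ f z‖ ≤ N)
    {L L₁ L₂ : List (Fin d)} (hL : (L₁ ++ L₂).Perm L) (α : Fin d → ℕ) (x y : Ed d) :
    |mpow y α| * (‖pdList L₁ (fun y => f y * (starRingEnd ℂ) (φ (y - x))) y‖ *
        ‖pdList L₂ (fun y => φ (y - x)) y‖) ≤
      (2 * ρ) ^ mlen α * ρ ^ L.length *
        ((mfact α : ℝ) * (mfact (fun i => L.count i) : ℝ)) ^ s * (C * N *
        ∫ w : Ed d, Real.exp (-‖(2 * Real.pi) • w‖ ^ (1 / s))) *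
        Real.exp (-‖x‖ ^ (1 / s)) := by
  obtain ⟨α₁, α₂, hα, hlen, hfact⟩ := exists_abs_mpow_le_mul x y α
  set J := ∫ w : Ed d, Real.exp (-‖(2 * Real.pi) • w‖ ^ (1 / s))
  have hJ : 0 ≤ J := integral_nonneg fun _ => (Real.exp_pos _).le
  have h₁ := norm_pdList_mul_window_le hs hκ hρ hE hf hφ hV L₁ x y
  have h₂ := hφC (y - x) α₂ fun i => L₂.count i
  rw [← pdList_eq_mderiv hφ.smooth, mlen_count] at h₂
  have h₃ := hE x α₁
  rw [pdList_comp_sub]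
  have hcount : (fun i => L.count i) = (fun i => L₁.count i) + fun i => L₂.count i := by
    funext i
    rw [← hL.count_eq, List.count_append, Pi.add_apply]
  have hm : (mfact (fun i => L₁.count i) : ℝ) * (mfact fun i => L₂.count i : ℝ) ≤
      mfact fun i => L.count i := by
    rw [hcount]
    exact_mod_cast mfact_mul_le _ _
  have hlenL : L.length = L₁.length + L₂.length := by
    rw [← hL.length_eq, List.length_append]
  have e : Real.exp (-‖x‖ ^ (1 / s)) =
      Real.exp (κ * ‖x‖ ^ (1 / s)) * Real.exp (-(κ + 1) * ‖x‖ ^ (1 / s)) := by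
    rw [← Real.exp_add]
    congr 1
    ring
  set a : ℝ := (mfact fun i => L₁.count i : ℝ)
  set b : ℝ := (mfact fun i => L₂.count i : ℝ)
  have ha : 0 ≤ a := Nat.cast_nonneg _
  have hb : 0 ≤ b := Nat.cast_nonneg _
  calc _ ≤ 2 ^ mlen α * (|mpow x α₁| * |mpow (y - x) α₂|) *
        (‖pdList L₁ (fun y => f y * (starRingEnd ℂ) (φ (y - x))) y‖ *
        ‖pdList L₂ φ (y - x)‖) := by gcongr
    _ = 2 ^ mlen α * (|mpow x α₁| *
        ‖pdList L₁ (fun y => f y * (starRingEnd ℂ) (φ (y - x))) y‖ *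
        (|mpow (y - x) α₂| * ‖pdList L₂ φ (y - x)‖)) := by ring
    _ ≤ 2 ^ mlen α * ((ρ ^ mlen α₁ * (mfact α₁ : ℝ) ^ s * Real.exp (κ * ‖x‖ ^ (1 / s))) *
        (N * Real.exp (-(κ + 1) * ‖x‖ ^ (1 / s)) * (ρ ^ L₁.length * a ^ s) * J) *
        (C * (ρ ^ (mlen α₂ + L₂.length) * ((mfact α₂ : ℝ) * b) ^ s))) := by gcongr
    _ = (2 * ρ) ^ mlen α * ρ ^ L.length * ((mfact α : ℝ) * (a * b)) ^ s * (C * N * J) *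
        Real.exp (-‖x‖ ^ (1 / s)) := by
      rw [e, hlenL, ← hlen, ← hfact, Nat.cast_mul]
      have q₁ : (0 : ℝ) ≤ mfact α₁ := Nat.cast_nonneg _
      have q₂ : (0 : ℝ) ≤ mfact α₂ := Nat.cast_nonneg _
      rw [Real.mul_rpow (mul_nonneg q₁ q₂) (mul_nonneg ha hb), Real.mul_rpow q₁ q₂,
        Real.mul_rpow ha hb, Real.mul_rpow q₂ hb, mul_pow]
      ring
    _ ≤ _ := by gcongr

lemma mpow_mul_norm_mderiv_le {κ ρ N C : ℝ} (hs : 0 < s) (hκ : 0 ≤ κ) (hρ : 0 ≤ ρ)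
    (hN : 0 ≤ N) (hC : 0 ≤ C)
    (hE : ∀ (v : Ed d) (γ : Fin d → ℕ),
      |mpow v γ| ≤ ρ ^ mlen γ * (mfact γ : ℝ) ^ s * Real.exp (κ * ‖v‖ ^ (1 / s)))
    (hf : HasL1Derivs f) (hφ : HasL1Derivs φ)
    (hφC : ∀ x α β, |mpow x α| * ‖mderiv β φ x‖ ≤
      C * (ρ ^ (mlen α + mlen β) * ((mfact α : ℝ) * (mfact β : ℝ)) ^ s))
    (hV : ∀ z, Real.exp (2 * (κ + 1) * pnorm z ^ (1 / s)) * ‖STFTgs φ f z‖ ≤ N)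
    (α β : Fin d → ℕ) (y : Ed d) :
    |mpow y α| * ‖mderiv β f y‖ * ‖∫ u, (starRingEnd ℂ) (φ u) * φ u‖ ≤
      (2 * ρ) ^ (mlen α + mlen β) * ((mfact α : ℝ) * (mfact β : ℝ)) ^ s * (C * N *
        ((∫ w : Ed d, Real.exp (-‖(2 * Real.pi) • w‖ ^ (1 / s))) *
          ∫ x : Ed d, Real.exp (-‖x‖ ^ (1 / s)))) := by
  obtain ⟨L, hL, hLf⟩ := exists_list_mderiv β
  have hβ : (fun i => L.count i) = β := funext hL
  have hlen : L.length = mlen β := by rw [← mlen_count, hβ]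
  have hterm : ∀ x, |mpow y α| *
      ‖pdList L (fun y => f y * ((starRingEnd ℂ) (φ (y - x)) * φ (y - x))) y‖ ≤ _ := fun x => by
    simp only [← mul_assoc]
    exact norm_pdList_mul_le (hf.mul (hφ.conj.comp_sub x)).smooth (hφ.comp_sub x).smooth L y
      (abs_nonneg _) fun L₁ L₂ h =>
        mpow_mul_norm_pdList_mul_le hs hκ hρ hN hC hE hf hφ hφC hV h α x y
  obtain ⟨-, hint⟩ := hf.integral_pdList_mul_comp_sub (hφ.conj.mul hφ) L y
  rw [hLf, mul_assoc, ← norm_mul, ← hint, ← abs_of_nonneg (abs_nonneg (mpow y α)),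
    ← Real.norm_eq_abs |mpow y α|, ← norm_smul, ← integral_smul]
  have hnorm : ∀ x, ‖|mpow y α| •
      pdList L (fun y => f y * ((starRingEnd ℂ) (φ (y - x)) * φ (y - x))) y‖ =
      |mpow y α| *
        ‖pdList L (fun y => f y * ((starRingEnd ℂ) (φ (y - x)) * φ (y - x))) y‖ := fun x => by
    rw [norm_smul, Real.norm_eq_abs, abs_abs]
  refine (norm_integral_le_of_norm_le (((integrable_exp_neg_norm_rpow hs).const_mul _).const_mul _)
    (Eventually.of_forall fun x => (hnorm x).trans_le (hterm x))).trans (le_of_eq ?_)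
  rw [integral_const_mul, integral_const_mul, hβ, hlen]
  ring

end Estimate

theorem statement5 (d : ℕ) (hd : 1 ≤ d) (s : ℝ) (hs : 1/2 < s)
    (φ : Ed d → ℂ) (hφ : φ ∈ SigmaGS s d) (hφ0 : φ ≠ 0)
    (h : ℝ) (hh : 0 < h) :
    ∃ A C : ℝ, 0 < A ∧ 0 < C ∧ ∀ f ∈ SigmaGS s d,
      GSnorm s h f ≤ ENNReal.ofReal C *
        (⨆ z : Ed d × Ed d, ENNReal.ofReal (Real.exp (A * pnorm z ^ (1/s)) * ‖STFTgs φ f z‖)) := by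
  have hs0 : 0 < s := by linarith
  have hρ : 0 < h / 2 := by positivity
  have hφL := SigmaGS.hasL1Derivs hφ
  obtain ⟨C, hC, hφC⟩ := GSnorm.exists_bound hρ (hφ.2 _ hρ)
  set b : ℝ := (h / 2) ^ (-(1 / s)) with hb
  have hb0 : 0 < b := by positivity
  have hbs : b ^ (-s) = h / 2 := by
    rw [hb, ← Real.rpow_mul hρ.le, neg_mul_neg, one_div_mul_cancel hs0.ne', Real.rpow_one]
  set κ : ℝ := s * b * d
  have hκ : 0 ≤ κ := by positivity
  have hE : ∀ (v : Ed d) (γ : Fin d → ℕ), |mpow v γ| ≤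
      (h / 2) ^ mlen γ * (mfact γ : ℝ) ^ s * Real.exp (κ * ‖v‖ ^ (1 / s)) := fun v γ => by
    rw [← hbs]
    exact abs_mpow_le_s5 hs0 hb0 v γ
  have hI : 0 < ‖∫ u, (starRingEnd ℂ) (φ u) * φ u‖ :=
    norm_pos_iff.2 (integral_conj_mul_self_ne_zero hφL hφ0)
  set I := ‖∫ u, (starRingEnd ℂ) (φ u) * φ u‖
  set J := (∫ w : Ed d, Real.exp (-‖(2 * Real.pi) • w‖ ^ (1 / s))) *
    ∫ x : Ed d, Real.exp (-‖x‖ ^ (1 / s))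
  have hJ : 0 ≤ J := mul_nonneg (integral_nonneg fun _ => (Real.exp_pos _).le)
    (integral_nonneg fun _ => (Real.exp_pos _).le)
  refine ⟨2 * (κ + 1), C * J / I + 1, by positivity, by positivity, fun f hf => ?_⟩
  set S := ⨆ z : Ed d × Ed d,
    ENNReal.ofReal (Real.exp (2 * (κ + 1) * pnorm z ^ (1 / s)) * ‖STFTgs φ f z‖) with hS
  have hK : 0 < C * J / I + 1 := by positivity
  by_cases hT : S = ⊤
  · rw [hT, ENNReal.mul_top (ENNReal.ofReal_pos.2 hK).ne']
    exact le_top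
  have hV : ∀ z, Real.exp (2 * (κ + 1) * pnorm z ^ (1 / s)) * ‖STFTgs φ f z‖ ≤ S.toReal :=
    fun z => (ENNReal.ofReal_le_iff_le_toReal hT).1 (le_iSup_of_le z le_rfl)
  have hN : 0 ≤ S.toReal := ENNReal.toReal_nonneg
  rw [← ENNReal.ofReal_toReal hT, ← ENNReal.ofReal_mul hK.le]
  refine iSup_le fun y => iSup_le fun α => iSup_le fun β => ENNReal.ofReal_le_ofReal ?_
  have key := mpow_mul_norm_mderiv_le hs0 hκ hρ.le hN hC hE (SigmaGS.hasL1Derivs hf) hφL hφC hV α β y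
  rw [mul_div_cancel₀ h two_ne_zero] at key
  have hα := mfact_pos α
  have hβ := mfact_pos β
  rw [div_le_iff₀ (by positivity)]
  set D := h ^ (mlen α + mlen β) * ((mfact α : ℝ) * (mfact β : ℝ)) ^ s
  have hD : 0 ≤ D := by positivity
  calc |mpow y α| * ‖mderiv β f y‖ ≤ D * (C * S.toReal * J) / I := (le_div_iff₀ hI).2 key
    _ = C * J / I * S.toReal * D := by ring
    _ ≤ (C * J / I + 1) * S.toReal * D := by
      gcongr
      linarith

end
end

section
/- Let s > 1/2 and let f be a measurable function on ℝ^d such that |f(x)| ≤ C₀ e^{M|x|^{1/s}} for all x ∈ ℝ^d, for some constants C₀ > 0 and M ≥ 0. Suppose there exists a nonempty open conic set Γ ⊆ ℝ^d \ {0} such that sup_{x ∈ Γ} e^{A|x|^{1/s}} |f(x)| < ∞ for all A > 0. Let g be a measurable function on ℝ^d with ∫_{ℝ^d} e^{A|x|^{1/s}} |g(x)| dx < ∞ for all A > 0. Then for any open conic set Γ' ⊆ ℝ^d \ {0} such that the closure of Γ' ∩ S_{d−1} is contained in Γ (where S_{d−1} is the unit sphere of ℝ^d), one has sup_{x ∈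 Γ'} e^{A|x|^{1/s}} |f * g(x)| < ∞ for all A > 0, where f * g denotes convolution. -/
open MeasureTheory Filter
open scoped BigOperators ENNReal RealInnerProductSpace

noncomputable section

/-- A crude form of subadditivity for powers of norms. -/
lemma norm_add_rpow_le_two_rpow_mul {V : Type*} [SeminormedAddCommGroup V] {p : ℝ} (hp : 0 ≤ p)
    (a b : V) : ‖a + b‖ ^ p ≤ 2 ^ p * (‖a‖ ^ p + ‖b‖ ^ p) := by
  have ha := Real.rpow_nonneg (norm_nonneg a) p
  have hb := Real.rpow_nonneg (norm_nonneg b) p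
  have h2 : (0 : ℝ) ≤ 2 ^ p := by positivity
  have hab := norm_add_le a b
  rcases le_total ‖a‖ ‖b‖ with h | h
  · calc ‖a + b‖ ^ p ≤ (2 * ‖b‖) ^ p :=
          Real.rpow_le_rpow (norm_nonneg _) (by linarith) hp
      _ = 2 ^ p * ‖b‖ ^ p := Real.mul_rpow zero_le_two (norm_nonneg _)
      _ ≤ _ := by gcongr; linarith
  · calc ‖a + b‖ ^ p ≤ (2 * ‖a‖) ^ p :=
          Real.rpow_le_rpow (norm_nonneg _) (by linarith) hp
      _ = 2 ^ p * ‖a‖ ^ p := Real.mul_rpow zero_le_two (norm_nonneg _)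
      _ ≤ _ := by gcongr; linarith

/-- A cone whose closed spherical section lies in an open cone `Γ` stays in `Γ` under relatively
small perturbations. -/
lemma exists_pos_forall_sub_mem_of_isConic {V : Type*} [NormedAddCommGroup V] [NormedSpace ℝ V]
    [FiniteDimensional ℝ V] {Γ Γ' : Set V} (hΓo : IsOpen Γ) (hΓc : IsConic Γ)
    (hΓ'c : IsConic Γ') (hΓ'0 : (0 : V) ∉ Γ')
    (hincl : closure (Γ' ∩ Metric.sphere (0 : V) 1) ⊆ Γ) :
    ∃ ε : ℝ, 0 < ε ∧ ∀ x ∈ Γ', ∀ y : V, ‖y‖ < ε * ‖x‖ → x - y ∈ Γ := by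
  have hK : IsCompact (closure (Γ' ∩ Metric.sphere (0 : V) 1)) :=
    ((isCompact_sphere (0 : V) 1).of_isClosed_subset isClosed_closure
      (closure_minimal Set.inter_subset_right Metric.isClosed_sphere))
  obtain ⟨ε, hε, hsub⟩ := hK.exists_thickening_subset_open hΓo hincl
  refine ⟨ε, hε, fun x hx y hy => ?_⟩
  have hx0 : 0 < ‖x‖ := norm_pos_iff.2 fun h => hΓ'0 (h ▸ hx)
  have hmem : ‖x‖⁻¹ • x ∈ closure (Γ' ∩ Metric.sphere (0 : V) 1) := by
    refine subset_closure ⟨hΓ'c _ (inv_pos.2 hx0) x hx, ?_⟩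
    simp [norm_smul, hx0.ne']
  have hthick : ‖x‖⁻¹ • (x - y) ∈ Γ := by
    refine hsub (Metric.mem_thickening_iff.2 ⟨_, hmem, ?_⟩)
    rw [dist_eq_norm, smul_sub, sub_sub_cancel_left, norm_neg, norm_smul, norm_inv, norm_norm,
      inv_mul_lt_iff₀ hx0]
    linarith
  simpa [smul_smul, hx0.ne'] using hΓc ‖x‖ hx0 _ hthick

theorem statement6 (d : ℕ) (s : ℝ) (hs : 1/2 < s)
    (f g : Ed d → ℂ) (hf : Measurable f) (hg : Measurable g)
    (C₀ M : ℝ) (hC₀ : 0 < C₀) (hM : 0 ≤ M)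
    (hfbd : ∀ x : Ed d, ‖f x‖ ≤ C₀ * Real.exp (M * ‖x‖ ^ (1/s)))
    (Γ : Set (Ed d)) (hΓo : IsOpen Γ) (hΓc : IsConic Γ) (hΓ0 : (0 : Ed d) ∉ Γ)
    (hΓne : Γ.Nonempty)
    (hfΓ : ∀ A : ℝ, 0 < A → ∃ C : ℝ, ∀ x ∈ Γ, Real.exp (A * ‖x‖ ^ (1/s)) * ‖f x‖ ≤ C)
    (hgint : ∀ A : ℝ, 0 < A →
      MeasureTheory.Integrable (fun x : Ed d => Real.exp (A * ‖x‖ ^ (1/s)) * ‖g x‖))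
    (Γ' : Set (Ed d)) (hΓ'o : IsOpen Γ') (hΓ'c : IsConic Γ') (hΓ'0 : (0 : Ed d) ∉ Γ')
    (hincl : closure (Γ' ∩ Metric.sphere (0 : Ed d) 1) ⊆ Γ) :
    ∀ A : ℝ, 0 < A → ∃ C : ℝ, ∀ x ∈ Γ',
      Real.exp (A * ‖x‖ ^ (1/s)) * ‖∫ y : Ed d, f (x - y) * g y‖ ≤ C := by
  intro A hA
  obtain ⟨ε, hε, hcone⟩ := exists_pos_forall_sub_mem_of_isConic hΓo hΓc hΓ'c hΓ'0 hincl
  have hp : (0 : ℝ) ≤ 1 / s := by positivity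
  set p : ℝ := 1 / s
  have hk : (0 : ℝ) < 2 ^ p := by positivity
  obtain ⟨C, hC⟩ := hfΓ (A * 2 ^ p) (by positivity)
  set B : ℝ := A * 2 ^ p + (A * ε⁻¹ ^ p + M * (1 + ε⁻¹) ^ p) with hB
  have hB2 : 0 ≤ A * ε⁻¹ ^ p + M * (1 + ε⁻¹) ^ p := by positivity
  have hB1 : 0 < A * 2 ^ p := by positivity
  have key : ∀ x ∈ Γ', ∀ y : Ed d, Real.exp (A * ‖x‖ ^ p) * ‖f (x - y)‖ ≤
      (max C 0 + C₀) * Real.exp (B * ‖y‖ ^ p) := by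
    intro x hx y
    have hyp := Real.rpow_nonneg (norm_nonneg y) p
    rcases lt_or_ge ‖y‖ (ε * ‖x‖) with h | h
    · have hxy := norm_add_rpow_le_two_rpow_mul hp (x - y) y
      rw [sub_add_cancel] at hxy
      calc Real.exp (A * ‖x‖ ^ p) * ‖f (x - y)‖
          ≤ Real.exp (A * 2 ^ p * ‖x - y‖ ^ p + B * ‖y‖ ^ p) * ‖f (x - y)‖ := by
            gcongr
            nlinarith [mul_le_mul_of_nonneg_left hxy hA.le, mul_nonneg hB2 hyp]
        _ = (Real.exp (A * 2 ^ p * ‖x - y‖ ^ p) * ‖f (x - y)‖) * Real.exp (B * ‖y‖ ^ p) := by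
            rw [Real.exp_add]; ring
        _ ≤ _ := by
            gcongr
            linarith [hC _ (hcone x hx y h), le_max_left C 0]
    · have hx1 : ‖x‖ ≤ ε⁻¹ * ‖y‖ := (le_inv_mul_iff₀ hε).2 h
      have hx2 : ‖x‖ ^ p ≤ ε⁻¹ ^ p * ‖y‖ ^ p := by
        rw [← Real.mul_rpow (by positivity) (norm_nonneg _)]
        exact Real.rpow_le_rpow (norm_nonneg _) hx1 hp
      have hxy : ‖x - y‖ ^ p ≤ (1 + ε⁻¹) ^ p * ‖y‖ ^ p := by
        rw [← Real.mul_rpow (by positivity) (norm_nonneg _)]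
        exact Real.rpow_le_rpow (norm_nonneg _) (by linarith [norm_sub_le x y]) hp
      calc Real.exp (A * ‖x‖ ^ p) * ‖f (x - y)‖
          ≤ Real.exp (A * ‖x‖ ^ p) * (C₀ * Real.exp (M * ‖x - y‖ ^ p)) := by
            gcongr; exact hfbd _
        _ = C₀ * Real.exp (A * ‖x‖ ^ p + M * ‖x - y‖ ^ p) := by rw [Real.exp_add]; ring
        _ ≤ _ := by
            gcongr
            · linarith [le_max_right C 0]
            · nlinarith [mul_le_mul_of_nonneg_left hxy hM, mul_le_mul_of_nonneg_left hx2 hA.le,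
                mul_nonneg hB1.le hyp]
  have hint := (hgint B (by positivity)).const_mul (max C 0 + C₀)
  refine ⟨∫ y, (max C 0 + C₀) * (Real.exp (B * ‖y‖ ^ p) * ‖g y‖), fun x hx => ?_⟩
  have hnorm : Real.exp (A * ‖x‖ ^ p) * ‖∫ y : Ed d, f (x - y) * g y‖ =
      ‖∫ y : Ed d, Real.exp (A * ‖x‖ ^ p) • (f (x - y) * g y)‖ := by
    rw [integral_smul, norm_smul, Real.norm_of_nonneg (Real.exp_pos _).le]
  rw [hnorm]
  refine norm_integral_le_of_norm_le hint (.of_forall fun y => ?_)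
  rw [norm_smul, Real.norm_of_nonneg (Real.exp_pos _).le, norm_mul, ← mul_assoc, ← mul_assoc]
  exact mul_le_mul_of_nonneg_right (key x hx y) (norm_nonneg _)

end
end
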